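/- Suppose ξ has span 1. Then there exist constants β, δ > 0 and C > 0 such that G(z, x) extends to an analytic function of (z, x) ∈ Δ(β, δ) × Δ(β, δ) and H(z, x, y) extends to an analytic function of (z, x, y) ∈ Δ(β, δ)³, with the bounds |G(z, x)| ≤ C |1 − x|^{−1} and |H(z, x, y)| ≤ C |1 − z|^{−1/2} |1 − x|^{−1} |1 − y|^{−1} for all x, y, z ∈ Δ(β, δ). -/

import Mathlib

open scoped ENNReal BigOperators
open Set Filter

/-- Plane (ordered rooted) trees. -/
inductive PlaneTree : Type
  | node : List PlaneTree → PlaneTree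

namespace PlaneTree

/-- The list of subtrees hanging off the root. -/
def children : PlaneTree → List PlaneTree
  | .node ts => ts

/-- The subtree rooted at a given position (sequence of child indices), if it exists. -/
def subtreeAt : PlaneTree → List ℕ → Option PlaneTree
  | t, [] => some t
  | .node ts, i :: q =>
    match ts[i]? with
    | some t' => subtreeAt t' q
    | none => none

/-- The vertex set of a tree, with vertices identified with their positions. -/
def vertexSet (t : PlaneTree) : Set (List ℕ) := {q | (subtreeAt t q).isSome}

/-- The number of vertices of a tree. -/
noncomputable def size (t : PlaneTree) : ℕ := (vertexSet t).ncard

/-- The number of children of the vertex at position `q`. -/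
def childCount (t : PlaneTree) (q : List ℕ) : ℕ :=
  ((subtreeAt t q).map fun t' => t'.children.length).getD 0

end PlaneTree

/-- Longest common prefix of two positions; this is the position of the last common
ancestor of the two vertices. -/
def lca : List ℕ → List ℕ → List ℕ
  | a :: as, b :: bs => if a = b then a :: lca as bs else []
  | _, _ => []

/-- The distance from `v` up to the last common ancestor of `v` and `w`. -/
def dUp (v w : List ℕ) : ℕ := v.length - (lca v w).length

/-- The graph distance between the vertices at positions `v` and `w`. -/
def treeDist (v w : List ℕ) : ℕ := dUp v w + dUp w v

/-- The Galton–Watson probability of a given finite tree: the product, over all vertices,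
of the probability that the offspring distribution takes the value given by the number of
children of the vertex. -/
noncomputable def gwProb (p : ℕ → ℝ≥0∞) (t : PlaneTree) : ℝ≥0∞ :=
  ∏ᶠ v ∈ PlaneTree.vertexSet t, p (PlaneTree.childCount t v)

/-- `P(|𝒯| = n)` for the Galton–Watson tree `𝒯`. -/
noncomputable def probSize (p : ℕ → ℝ≥0∞) (n : ℕ) : ℝ≥0∞ :=
  ∑' t : PlaneTree, if PlaneTree.size t = n then gwProb p t else 0

/-- `E f(T_n)` where `T_n` is the Galton–Watson tree conditioned to have `n` vertices. -/
noncomputable def condExp (p : ℕ → ℝ≥0∞) (n : ℕ) (f : PlaneTree → ℝ≥0∞) : ℝ≥0∞ :=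
  (∑' t : PlaneTree, if PlaneTree.size t = n then gwProb p t * f t else 0) / probSize p n

/-- The variance of the offspring distribution `p` (which has mean `1`). -/
noncomputable def xiVar (p : ℕ → ℝ≥0∞) : ℝ≥0∞ :=
  ∑' k : ℕ, p k * ENNReal.ofReal (((k : ℝ) - 1) ^ 2)

/-- `P_k(t)`: the number of unordered pairs of vertices of `t` at graph distance `k`. -/
noncomputable def pairCount (t : PlaneTree) (k : ℕ) : ℕ :=
  {s : Set (List ℕ) | ∃ v w, v ∈ PlaneTree.vertexSet t ∧ w ∈ PlaneTree.vertexSet t ∧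
    s = {v, w} ∧ treeDist v w = k}.ncard

/-- The singularity-analysis domain `Δ(β, δ)`. -/
def Delta (β δ : ℝ) : Set ℂ :=
  {z : ℂ | ‖z‖ < 1 + δ ∧ z ≠ 1 ∧ Real.pi / 2 - β < |Complex.arg (z - 1)|}

/-- `G(z, x) = E (z^{|𝒯|} ∑_{v ∈ 𝒯} x^{d(v, o)})`, where `o` is the root. -/
noncomputable def Ggen (p : ℕ → ℝ≥0∞) (z x : ℂ) : ℂ :=
  ∑' t : PlaneTree, ((gwProb p t).toReal : ℂ) * z ^ PlaneTree.size t *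
    ∑ᶠ v ∈ PlaneTree.vertexSet t, x ^ v.length

/-- `H(z, x, y) = E (z^{|𝒯|} ∑_{v,w ∈ 𝒯} x^{d(v, v∧w)} y^{d(w, v∧w)})`
(sum over ordered pairs of vertices). -/
noncomputable def Hgen (p : ℕ → ℝ≥0∞) (z x y : ℂ) : ℂ :=
  ∑' t : PlaneTree, ((gwProb p t).toReal : ℂ) * z ^ PlaneTree.size t *
    ∑ᶠ v ∈ PlaneTree.vertexSet t, ∑ᶠ w ∈ PlaneTree.vertexSet t,
      x ^ dUp v w * y ^ dUp w v

/-- Critical offspring laws with finite positive variance and span one, as real sequences. -/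
structure CriticalLaw (a : ℕ → ℝ) : Prop where
  nonneg : ∀ k, 0 ≤ a k
  summable_sq : Summable fun k : ℕ => (k : ℝ) ^ 2 * a k
  hasSum : HasSum a 1
  hasSum_mean : HasSum (fun k : ℕ => (k : ℝ) * a k) 1
  zero_pos : 0 < a 0
  exists_two_le : ∃ k, 2 ≤ k ∧ 0 < a k
  span : ∀ e : ℕ, (∀ k, a k ≠ 0 → e ∣ k) → e ≤ 1

namespace CriticalLaw

variable {a : ℕ → ℝ}

/-- The probability generating function. -/
noncomputable def pgf (a : ℕ → ℝ) (u : ℂ) : ℂ := ∑' k : ℕ, (a k : ℂ) * u ^ k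

/-- The first derivative of the probability generating function, as a power series. -/
noncomputable def pgf₁ (a : ℕ → ℝ) (u : ℂ) : ℂ := ∑' k : ℕ, (a k : ℂ) * (k * u ^ (k - 1))

/-- The second derivative of the probability generating function, as a power series. -/
noncomputable def pgf₂ (a : ℕ → ℝ) (u : ℂ) : ℂ :=
  ∑' k : ℕ, (a k : ℂ) * (k * (k - 1) * u ^ (k - 2))

/-- The quotient `(Φ(u) - u) / (u - 1)²`, as a power series. -/
noncomputable def pgfQuot (a : ℕ → ℝ) (u : ℂ) : ℂ :=
  ∑' k : ℕ, (a k : ℂ) * ∑ j ∈ Finset.range k, ∑ i ∈ Finset.range j, u ^ i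

/-- The quotient `(Φ'(u) - 1) / (u - 1)`, as a power series. -/
noncomputable def pgfQuot₁ (a : ℕ → ℝ) (u : ℂ) : ℂ :=
  ∑' k : ℕ, (a k : ℂ) * (k * ∑ i ∈ Finset.range (k - 1), u ^ i)

theorem hasSum_of_eq {ι E : Type*} [AddCommMonoid E] [TopologicalSpace E] {f g : ι → E} {x y : E}
    (h : HasSum g y) (hf : ∀ i, f i = g i) (hx : x = y) : HasSum f x := by
  rwa [hx, funext hf]

theorem norm_term_le (ha : CriticalLaw a) {f : ℂ} {k : ℕ} {c : ℝ} (hf : ‖f‖ ≤ c) :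
    ‖(a k : ℂ) * f‖ ≤ c * a k := by
  rw [norm_mul, Complex.norm_real, Real.norm_of_nonneg (ha.nonneg k), mul_comm]
  exact mul_le_mul_of_nonneg_right hf (ha.nonneg k)

theorem norm_pow_le_one {u : ℂ} (hu : ‖u‖ ≤ 1) (k : ℕ) : ‖u ^ k‖ ≤ 1 := by
  rw [norm_pow]; exact pow_le_one₀ (norm_nonneg _) hu

theorem norm_geom_le {u : ℂ} (hu : ‖u‖ ≤ 1) (k : ℕ) : ‖∑ i ∈ Finset.range k, u ^ i‖ ≤ k := by
  calc _ ≤ ∑ i ∈ Finset.range k, (1 : ℝ) := norm_sum_le_of_le _ fun i _ => norm_pow_le_one hu i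
    _ = k := by simp

theorem norm_pgf₁_factor_le {u : ℂ} (hu : ‖u‖ ≤ 1) (k : ℕ) : ‖(k : ℂ) * u ^ (k - 1)‖ ≤ k := by
  rw [norm_mul, Complex.norm_natCast]
  exact mul_le_of_le_one_right (Nat.cast_nonneg _) (norm_pow_le_one hu _)

theorem norm_pgf₂_factor_le {u : ℂ} (hu : ‖u‖ ≤ 1) (k : ℕ) :
    ‖(k : ℂ) * (k - 1) * u ^ (k - 2)‖ ≤ (k : ℝ) ^ 2 := by
  rcases k with _ | k
  · simp
  · have h := norm_pow_le_one hu (k + 1 - 2)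
    have e : (((k + 1 : ℕ) : ℂ) - 1) = (k : ℂ) := by push_cast; ring
    rw [e, norm_mul, norm_mul, Complex.norm_natCast, Complex.norm_natCast]
    push_cast
    have : (0 : ℝ) ≤ k := Nat.cast_nonneg _
    refine (mul_le_of_le_one_right (by positivity : (0 : ℝ) ≤ (k + 1) * k) h).trans ?_
    nlinarith

theorem norm_pgfQuot_factor_le {u : ℂ} (hu : ‖u‖ ≤ 1) (k : ℕ) :
    ‖∑ j ∈ Finset.range k, ∑ i ∈ Finset.range j, u ^ i‖ ≤ (k : ℝ) ^ 2 := by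
  calc _ ≤ ∑ j ∈ Finset.range k, (k : ℝ) := norm_sum_le_of_le _ fun j hj =>
        (norm_geom_le hu j).trans (by exact_mod_cast (Finset.mem_range.1 hj).le)
    _ = (k : ℝ) ^ 2 := by simp [sq]

theorem norm_pgfQuot₁_factor_le {u : ℂ} (hu : ‖u‖ ≤ 1) (k : ℕ) :
    ‖(k : ℂ) * ∑ i ∈ Finset.range (k - 1), u ^ i‖ ≤ (k : ℝ) ^ 2 := by
  rw [norm_mul, Complex.norm_natCast, sq]
  exact mul_le_mul_of_nonneg_left ((norm_geom_le hu _).trans (by exact_mod_cast k.sub_le 1))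
    (Nat.cast_nonneg _)

theorem summable_of_norm_le_sq (ha : CriticalLaw a) {f : ℕ → ℂ} (hf : ∀ k : ℕ, ‖f k‖ ≤ (k : ℝ) ^ 2) :
    Summable fun k => (a k : ℂ) * f k :=
  .of_norm_bounded ha.summable_sq fun k => ha.norm_term_le (hf k)

theorem hasSum_pgf (ha : CriticalLaw a) {u : ℂ} (hu : ‖u‖ ≤ 1) :
    HasSum (fun k : ℕ => (a k : ℂ) * u ^ k) (pgf a u) :=
  (Summable.of_norm_bounded ha.hasSum.summable fun k => by
    simpa using ha.norm_term_le (norm_pow_le_one hu k)).hasSum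

theorem hasSum_pgf₁ (ha : CriticalLaw a) {u : ℂ} (hu : ‖u‖ ≤ 1) :
    HasSum (fun k : ℕ => (a k : ℂ) * (k * u ^ (k - 1))) (pgf₁ a u) :=
  (Summable.of_norm_bounded ha.hasSum_mean.summable fun k =>
    ha.norm_term_le (norm_pgf₁_factor_le hu k)).hasSum

theorem hasSum_pgf₂ (ha : CriticalLaw a) {u : ℂ} (hu : ‖u‖ ≤ 1) :
    HasSum (fun k : ℕ => (a k : ℂ) * (k * (k - 1) * u ^ (k - 2))) (pgf₂ a u) :=
  (ha.summable_of_norm_le_sq (norm_pgf₂_factor_le hu)).hasSum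

theorem hasSum_pgfQuot (ha : CriticalLaw a) {u : ℂ} (hu : ‖u‖ ≤ 1) :
    HasSum (fun k : ℕ => (a k : ℂ) * ∑ j ∈ Finset.range k, ∑ i ∈ Finset.range j, u ^ i)
      (pgfQuot a u) :=
  (ha.summable_of_norm_le_sq (norm_pgfQuot_factor_le hu)).hasSum

theorem hasSum_pgfQuot₁ (ha : CriticalLaw a) {u : ℂ} (hu : ‖u‖ ≤ 1) :
    HasSum (fun k : ℕ => (a k : ℂ) * (k * ∑ i ∈ Finset.range (k - 1), u ^ i)) (pgfQuot₁ a u) :=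
  (ha.summable_of_norm_le_sq (norm_pgfQuot₁_factor_le hu)).hasSum

theorem hasSum_ofReal (ha : CriticalLaw a) : HasSum (fun k => (a k : ℂ)) 1 :=
  hasSum_of_eq (Complex.hasSum_ofReal.2 ha.hasSum) (fun _ => rfl) (by simp)

theorem hasSum_mean_ofReal (ha : CriticalLaw a) : HasSum (fun k : ℕ => (k : ℂ) * (a k : ℂ)) 1 :=
  hasSum_of_eq (Complex.hasSum_ofReal.2 ha.hasSum_mean) (fun _ => by simp) (by simp)

theorem continuousOn_pgf (ha : CriticalLaw a) : ContinuousOn (pgf a) (Metric.closedBall 0 1) :=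
  continuousOn_tsum (fun k => by fun_prop) ha.hasSum.summable fun k u hu => by
    simpa using ha.norm_term_le (norm_pow_le_one (mem_closedBall_zero_iff.1 hu) k)

theorem continuousOn_pgf₁ (ha : CriticalLaw a) : ContinuousOn (pgf₁ a) (Metric.closedBall 0 1) :=
  continuousOn_tsum (fun k => by fun_prop) ha.hasSum_mean.summable fun k u hu =>
    ha.norm_term_le (norm_pgf₁_factor_le (mem_closedBall_zero_iff.1 hu) k)

theorem continuousOn_pgfQuot (ha : CriticalLaw a) :
    ContinuousOn (pgfQuot a) (Metric.closedBall 0 1) :=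
  continuousOn_tsum (fun k => by fun_prop) ha.summable_sq fun k u hu =>
    ha.norm_term_le (norm_pgfQuot_factor_le (mem_closedBall_zero_iff.1 hu) k)

theorem continuousOn_pgfQuot₁ (ha : CriticalLaw a) :
    ContinuousOn (pgfQuot₁ a) (Metric.closedBall 0 1) :=
  continuousOn_tsum (fun k => by fun_prop) ha.summable_sq fun k u hu =>
    ha.norm_term_le (norm_pgfQuot₁_factor_le (mem_closedBall_zero_iff.1 hu) k)

theorem hasDerivAt_pgf (ha : CriticalLaw a) {u : ℂ} (hu : ‖u‖ < 1) :
    HasDerivAt (pgf a) (pgf₁ a u) u := by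
  refine hasDerivAt_tsum_of_isPreconnected (t := Metric.ball 0 1) ha.hasSum_mean.summable
    Metric.isOpen_ball (convex_ball _ _).isPreconnected
    (g := fun k y => (a k : ℂ) * y ^ k) (g' := fun k y => (a k : ℂ) * (k * y ^ (k - 1)))
    (fun k y _ => (hasDerivAt_pow k y).const_mul _)
    (fun k y hy => ha.norm_term_le (norm_pgf₁_factor_le (mem_ball_zero_iff.1 hy).le k))
    (Metric.mem_ball_self one_pos) (ha.hasSum_pgf (by simp)).summable (mem_ball_zero_iff.2 hu)

theorem analyticAt_pgf (ha : CriticalLaw a) {u : ℂ} (hu : ‖u‖ < 1) : AnalyticAt ℂ (pgf a) u :=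
  DifferentiableOn.analyticAt (s := Metric.ball 0 1)
    (fun _ hy => (ha.hasDerivAt_pgf (mem_ball_zero_iff.1 hy)).differentiableAt.differentiableWithinAt)
    (Metric.isOpen_ball.mem_nhds (mem_ball_zero_iff.2 hu))

theorem analyticAt_pgf₁ (ha : CriticalLaw a) {u : ℂ} (hu : ‖u‖ < 1) : AnalyticAt ℂ (pgf₁ a) u :=
  (Complex.differentiableOn_tsum_of_summable_norm ha.hasSum_mean.summable (fun k => by fun_prop)
    Metric.isOpen_ball fun k _ hy => ha.norm_term_le
      (norm_pgf₁_factor_le (mem_ball_zero_iff.1 hy).le k)).analyticAt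
    (Metric.isOpen_ball.mem_nhds (mem_ball_zero_iff.2 hu))

theorem analyticAt_pgf₂ (ha : CriticalLaw a) {u : ℂ} (hu : ‖u‖ < 1) : AnalyticAt ℂ (pgf₂ a) u :=
  (Complex.differentiableOn_tsum_of_summable_norm ha.summable_sq (fun k => by fun_prop)
    Metric.isOpen_ball fun k _ hy => ha.norm_term_le
      (norm_pgf₂_factor_le (mem_ball_zero_iff.1 hy).le k)).analyticAt
    (Metric.isOpen_ball.mem_nhds (mem_ball_zero_iff.2 hu))

theorem norm_pgf₂_le (ha : CriticalLaw a) {u : ℂ} (hu : ‖u‖ ≤ 1) :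
    ‖pgf₂ a u‖ ≤ ∑' k : ℕ, (k : ℝ) ^ 2 * a k :=
  tsum_of_norm_bounded ha.summable_sq.hasSum fun k => ha.norm_term_le (norm_pgf₂_factor_le hu k)

theorem pgf_eq (ha : CriticalLaw a) {u : ℂ} (hu : ‖u‖ ≤ 1) :
    pgf a u = u + (1 - u) ^ 2 * pgfQuot a u := by
  refine (ha.hasSum_pgf hu).unique ?_
  convert (ha.hasSum_ofReal.add ((ha.hasSum_mean_ofReal.mul_left (u - 1)).add
    ((ha.hasSum_pgfQuot hu).mul_left ((1 - u) ^ 2)))) using 1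
  · funext k
    have h1 : (u - 1) * ∑ j ∈ Finset.range k, ∑ i ∈ Finset.range j, u ^ i
        = ∑ j ∈ Finset.range k, (u ^ j - 1) := by
      rw [Finset.mul_sum]
      exact Finset.sum_congr rfl fun j _ => mul_geom_sum u j
    rw [Finset.sum_sub_distrib] at h1
    have h2 := mul_geom_sum u k
    simp only [Finset.sum_const, Finset.card_range, nsmul_eq_mul, mul_one] at h1
    linear_combination (-(a k : ℂ)) * (h2 + (u - 1) * h1)
  · ring

theorem pgf₁_eq (ha : CriticalLaw a) {u : ℂ} (hu : ‖u‖ ≤ 1) :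
    pgf₁ a u = 1 - (1 - u) * pgfQuot₁ a u := by
  refine (ha.hasSum_pgf₁ hu).unique ?_
  refine hasSum_of_eq (ha.hasSum_mean_ofReal.sub ((ha.hasSum_pgfQuot₁ hu).mul_left (1 - u)))
    (fun k => ?_) rfl
  linear_combination (-(a k : ℂ)) * k * mul_geom_sum u (k - 1)

/-- Half the second factorial moment. -/
noncomputable def halfVar (a : ℕ → ℝ) : ℝ := ∑' k : ℕ, a k * ((k : ℝ) * (k - 1) / 2)

theorem halfVar_pos (ha : CriticalLaw a) : 0 < halfVar a := by
  have h0 : ∀ k : ℕ, (0 : ℝ) ≤ (k : ℝ) * (k - 1) / 2 := fun k => by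
    rcases k with _ | k
    · simp
    · push_cast; have : (0 : ℝ) ≤ k := Nat.cast_nonneg _
      nlinarith
  have hs : Summable fun k : ℕ => a k * ((k : ℝ) * (k - 1) / 2) := by
    refine .of_nonneg_of_le (fun k => mul_nonneg (ha.nonneg k) (h0 k)) (fun k => ?_) ha.summable_sq
    have := ha.nonneg k
    have hk : (0 : ℝ) ≤ k := Nat.cast_nonneg _
    nlinarith [mul_nonneg this hk, mul_nonneg this (mul_nonneg hk hk)]
  obtain ⟨k, hk, hak⟩ := ha.exists_two_le
  refine hs.tsum_pos (fun k => mul_nonneg (ha.nonneg k) (h0 k)) k (mul_pos hak ?_)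
  have : (2 : ℝ) ≤ k := by exact_mod_cast hk
  nlinarith

theorem pgfQuot_one (a : ℕ → ℝ) : pgfQuot a 1 = halfVar a := by
  rw [pgfQuot, halfVar, Complex.ofReal_tsum]
  congr 1; funext k
  have : ∀ k : ℕ, ∑ j ∈ Finset.range k, (j : ℂ) = k * (k - 1) / 2 := fun k => by
    induction k with
    | zero => simp
    | succ n ih => rw [Finset.sum_range_succ, ih]; push_cast; ring
  simp [this]

theorem pgfQuot₁_one (a : ℕ → ℝ) : pgfQuot₁ a 1 = 2 * halfVar a := by
  rw [pgfQuot₁, halfVar, Complex.ofReal_tsum, ← tsum_mul_left]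
  congr 1; funext k
  rcases k with _ | k
  · simp
  · simp; ring

theorem pgf_one (ha : CriticalLaw a) : pgf a 1 = 1 := by
  simpa using ha.pgf_eq (u := 1) (by simp)

theorem norm_pgf₁_lt_one (ha : CriticalLaw a) {u : ℂ} (hu : ‖u‖ < 1) : ‖pgf₁ a u‖ < 1 := by
  obtain ⟨k, hk, hak⟩ := ha.exists_two_le
  have hs : Summable fun k : ℕ => ‖(a k : ℂ) * (k * u ^ (k - 1))‖ :=
    .of_nonneg_of_le (fun _ => norm_nonneg _)
      (fun k => ha.norm_term_le (norm_pgf₁_factor_le hu.le k)) ha.hasSum_mean.summable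
  refine (norm_tsum_le_tsum_norm hs).trans_lt ?_
  rw [← ha.hasSum_mean.tsum_eq]
  refine hs.tsum_lt_tsum (i := k) (fun k => ha.norm_term_le (norm_pgf₁_factor_le hu.le k)) ?_
    ha.hasSum_mean.summable
  rw [norm_mul, norm_mul, Complex.norm_real, Real.norm_of_nonneg hak.le, Complex.norm_natCast,
    norm_pow]
  have h1 : ‖u‖ ^ (k - 1) < 1 := pow_lt_one₀ (norm_nonneg _) hu (by omega)
  have h2 : (0 : ℝ) < k := by exact_mod_cast (by omega : 0 < k)
  nlinarith [mul_pos hak h2]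

theorem hasSum_excess (ha : CriticalLaw a) : HasSum (fun k : ℕ => (k : ℝ) * a (k + 1)) (a 0) := by
  have h := ha.hasSum_mean.sub ha.hasSum
  have h' := (hasSum_nat_add_iff' 1).2 h
  exact hasSum_of_eq h' (fun k => by push_cast; ring) (by simp)

theorem eq_of_mul_pgf_eq (ha : CriticalLaw a) {u v : ℂ} (hu : ‖u‖ ≤ 1) (hv : ‖v‖ < 1)
    (h : u * pgf a v = v * pgf a u) : u = v := by
  have h1 := ((ha.hasSum_pgf hv.le).mul_left u).sub ((ha.hasSum_pgf hu).mul_left v)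
  rw [h, sub_self] at h1
  have h2 := (hasSum_nat_add_iff' 1).2 h1
  have key : ‖(a 0 : ℂ) * (u - v)‖ ≤ a 0 * (‖v‖ * ‖u - v‖) := by
    rw [← norm_neg]
    have e : -((a 0 : ℂ) * (u - v)) = ∑' k : ℕ, (u * ((a (k + 1) : ℂ) * v ^ (k + 1)) -
        v * ((a (k + 1) : ℂ) * u ^ (k + 1))) := by
      rw [h2.tsum_eq]; simp; ring
    rw [e]
    refine tsum_of_norm_bounded (ha.hasSum_excess.mul_right (‖v‖ * ‖u - v‖)) fun k => ?_
    have e2 : u * ((a (k + 1) : ℂ) * v ^ (k + 1)) - v * ((a (k + 1) : ℂ) * u ^ (k + 1))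
        = (a (k + 1) : ℂ) * (u * v * (v ^ k - u ^ k)) := by ring
    have h3 : ‖v ^ k - u ^ k‖ ≤ k * ‖u - v‖ := by
      rw [← Commute.mul_geom_sum₂ (Commute.all v u), norm_mul, norm_sub_rev, mul_comm]
      refine mul_le_mul_of_nonneg_right ?_ (norm_nonneg _)
      calc _ ≤ ∑ i ∈ Finset.range k, (1 : ℝ) := norm_sum_le_of_le _ fun i _ => by
            rw [norm_mul]
            exact mul_le_one₀ (norm_pow_le_one hv.le i) (norm_nonneg _) (norm_pow_le_one hu _)
        _ = k := by simp
    rw [e2]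
    refine (ha.norm_term_le (c := k * (‖v‖ * ‖u - v‖)) ?_).trans (le_of_eq (by ring))
    rw [norm_mul, norm_mul]
    calc ‖u‖ * ‖v‖ * ‖v ^ k - u ^ k‖ ≤ 1 * ‖v‖ * (k * ‖u - v‖) := by gcongr
      _ = _ := by ring
  rw [norm_mul, Complex.norm_real, Real.norm_of_nonneg ha.zero_pos.le] at key
  have h4 := le_of_mul_le_mul_left key ha.zero_pos
  rw [← sub_eq_zero, ← norm_eq_zero]
  nlinarith [norm_nonneg (u - v)]

theorem pgf_sub_mul_pgf₁_ne_zero (ha : CriticalLaw a) {u : ℂ} (hu : ‖u‖ < 1) :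
    pgf a u - u * pgf₁ a u ≠ 0 := by
  intro h
  have h1 := (ha.hasSum_pgf hu.le).sub ((ha.hasSum_pgf₁ hu.le).mul_left u)
  rw [h] at h1
  have h2 := (hasSum_nat_add_iff' 1).2 h1
  have key : ‖-(a 0 : ℂ)‖ ≤ a 0 * ‖u‖ := by
    have e : -(a 0 : ℂ) = ∑' k : ℕ, ((a (k + 1) : ℂ) * u ^ (k + 1) -
        u * ((a (k + 1) : ℂ) * ((k + 1 : ℕ) * u ^ (k + 1 - 1)))) := by
      rw [h2.tsum_eq]; simp
    rw [e]
    refine tsum_of_norm_bounded (ha.hasSum_excess.mul_right ‖u‖) fun k => ?_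
    have e2 : (a (k + 1) : ℂ) * u ^ (k + 1) -
        u * ((a (k + 1) : ℂ) * ((k + 1 : ℕ) * u ^ (k + 1 - 1)))
        = (a (k + 1) : ℂ) * (-(k * u * u ^ k)) := by simp; ring
    rw [e2]
    refine (ha.norm_term_le (c := k * ‖u‖) ?_).trans (le_of_eq (by ring))
    rw [norm_neg, norm_mul, norm_mul, Complex.norm_natCast]
    exact mul_le_of_le_one_right (by positivity) (norm_pow_le_one hu.le k)
  rw [norm_neg, Complex.norm_real, Real.norm_of_nonneg ha.zero_pos.le] at key
  nlinarith [ha.zero_pos]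

theorem pgf_zero (a : ℕ → ℝ) : pgf a 0 = a 0 := by
  rw [pgf, tsum_eq_single 0]
  · simp
  · intro k hk; simp [hk]

theorem eq_one_of_norm_pgf (ha : CriticalLaw a) {u : ℂ} (hu : ‖u‖ = 1) (h : 1 ≤ ‖pgf a u‖) :
    u = 1 := by
  have hpow : ∀ k, a k ≠ 0 → u ^ k = 1 := by
    intro k hk
    rcases Nat.eq_zero_or_pos k with rfl | hkpos
    · simp
    have hak : 0 < a k := lt_of_le_of_ne (ha.nonneg k) (Ne.symm hk)
    have hs := ha.hasSum_pgf hu.le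
    have h0k : (0 : ℕ) ∉ ({k} : Finset ℕ) := by simp; omega
    have e := hs.summable.sum_add_tsum_compl (s := {0, k})
    have e' := ha.hasSum.summable.sum_add_tsum_compl (s := {0, k})
    rw [ha.hasSum.tsum_eq, Finset.sum_insert h0k, Finset.sum_singleton] at e'
    rw [hs.tsum_eq, Finset.sum_insert h0k, Finset.sum_singleton, pow_zero, mul_one] at e
    have hb : ‖∑' x : ↥((({0, k} : Finset ℕ) : Set ℕ)ᶜ), (a x : ℂ) * u ^ (x : ℕ)‖ ≤
        ∑' x : ↥((({0, k} : Finset ℕ) : Set ℕ)ᶜ), a x :=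
      tsum_of_norm_bounded (ha.hasSum.summable.subtype _).hasSum fun x => by
        simp [hu, abs_of_nonneg (ha.nonneg _)]
    have hle : a 0 + a k ≤ ‖(a 0 : ℂ) + a k * u ^ k‖ := by
      have := norm_add_le ((a 0 : ℂ) + a k * u ^ k)
        (∑' x : ↥((({0, k} : Finset ℕ) : Set ℕ)ᶜ), (a x : ℂ) * u ^ (x : ℕ))
      rw [e] at this
      linarith
    set v := u ^ k with hv
    have hv1 : ‖v‖ = 1 := by rw [hv, norm_pow, hu, one_pow]
    have hsq : v.re * v.re + v.im * v.im = 1 := by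
      rw [← Complex.normSq_apply, Complex.normSq_eq_norm_sq, hv1, one_pow]
    have hsq2 : ‖(a 0 : ℂ) + a k * v‖ ^ 2 = (a 0 + a k * v.re) ^ 2 + (a k * v.im) ^ 2 := by
      rw [← Complex.normSq_eq_norm_sq, Complex.normSq_apply]; simp; ring
    have h5 : (a 0 + a k) ^ 2 ≤ (a 0 + a k * v.re) ^ 2 + (a k * v.im) ^ 2 := by
      rw [← hsq2]
      exact pow_le_pow_left₀ (add_nonneg ha.zero_pos.le hak.le) hle 2
    have hre : 1 ≤ v.re := by
      have h6 : (a 0 * a k) * 1 ≤ (a 0 * a k) * v.re := by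
        have h7 : (a k * v.re) ^ 2 + (a k * v.im) ^ 2 = a k ^ 2 := by
          linear_combination a k ^ 2 * hsq
        linarith
      exact le_of_mul_le_mul_left h6 (mul_pos ha.zero_pos hak)
    have him : v.im = 0 := by nlinarith
    have hre' : v.re = 1 := by nlinarith
    exact Complex.ext (by simpa using hre') (by simpa using him)
  have he := ha.span (orderOf u) fun k hk => orderOf_dvd_of_pow_eq_one (hpow k hk)
  obtain ⟨k, hk, hak⟩ := ha.exists_two_le
  have h0 : orderOf u ≠ 0 := fun h0 => by
    have := orderOf_dvd_of_pow_eq_one (hpow k hak.ne')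
    rw [h0, zero_dvd_iff] at this; omega
  exact orderOf_eq_one_iff.1 (by omega)

end CriticalLaw

namespace CriticalLaw

variable {a : ℕ → ℝ}

/-- The parameters `z` for which `u = z Φ(u)` has a solution in the open unit disc. -/
def fixSet (a : ℕ → ℝ) : Set ℂ := {z | ∃ u : ℂ, ‖u‖ < 1 ∧ u = z * pgf a u}

open Classical in
/-- The solution of `u = z Φ(u)` in the open unit disc. -/
noncomputable def branch (a : ℕ → ℝ) (z : ℂ) : ℂ :=
  if h : ∃ u : ℂ, ‖u‖ < 1 ∧ u = z * pgf a u then h.choose else 0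

theorem norm_branch_lt {z : ℂ} (hz : z ∈ fixSet a) : ‖branch a z‖ < 1 := by
  have hz' : ∃ u : ℂ, ‖u‖ < 1 ∧ u = z * pgf a u := hz
  rw [branch, dif_pos hz']; exact hz'.choose_spec.1

theorem branch_eq_mul {z : ℂ} (hz : z ∈ fixSet a) : branch a z = z * pgf a (branch a z) := by
  have hz' : ∃ u : ℂ, ‖u‖ < 1 ∧ u = z * pgf a u := hz
  rw [branch, dif_pos hz']; exact hz'.choose_spec.2

theorem branch_eq (ha : CriticalLaw a) {z u : ℂ} (hu : ‖u‖ < 1) (h : u = z * pgf a u) :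
    branch a z = u := by
  have hz : z ∈ fixSet a := ⟨u, hu, h⟩
  refine ha.eq_of_mul_pgf_eq (norm_branch_lt hz).le hu ?_
  have h' := branch_eq_mul hz
  linear_combination pgf a u * h' - pgf a (branch a z) * h

theorem pgf_ne_zero_of_fixed (ha : CriticalLaw a) {z u : ℂ} (h : u = z * pgf a u) :
    pgf a u ≠ 0 := by
  intro h0
  rw [h0, mul_zero] at h
  rw [h, pgf_zero] at h0
  exact ha.zero_pos.ne' (by exact_mod_cast h0)

theorem fixSet_mem_nhds_and_analyticAt_branch (ha : CriticalLaw a) {z : ℂ} (hz : z ∈ fixSet a) :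
    fixSet a ∈ nhds z ∧ AnalyticAt ℂ (branch a) z := by
  obtain ⟨u, hu, h⟩ := hz
  have h0 := ha.pgf_ne_zero_of_fixed h
  have hzu : u / pgf a u = z := by rw [div_eq_iff h0]; exact h
  have hψ : AnalyticAt ℂ (fun u => u / pgf a u) u := analyticAt_id.div (ha.analyticAt_pgf hu) h0
  have hd : deriv (fun u => u / pgf a u) u ≠ 0 := by
    have := ((hasDerivAt_id u).div (ha.hasDerivAt_pgf hu) h0).deriv
    have e : (fun u => u / pgf a u) = (id / pgf a) := rfl
    rw [e, this]
    refine div_ne_zero ?_ (pow_ne_zero _ h0)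
    simpa using ha.pgf_sub_mul_pgf₁_ne_zero hu
  set r := hψ.hasStrictDerivAt.localInverse _ _ _ hd with hr
  have hra : AnalyticAt ℂ r (u / pgf a u) := hψ.analyticAt_localInverse hd
  have hru : r (u / pgf a u) = u := HasStrictFDerivAt.localInverse_apply_image ..
  have hinv : ∀ᶠ y in nhds (u / pgf a u), r y / pgf a (r y) = y :=
    hψ.hasStrictDerivAt.eventually_right_inverse hd
  rw [hzu] at hra hru hinv
  have hc : Tendsto r (nhds z) (nhds u) := by simpa [hru] using hra.continuousAt.tendsto
  have h1 : ∀ᶠ y in nhds z, ‖r y‖ < 1 := hc.norm.eventually_lt_const hu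
  have h2 : ∀ᶠ y in nhds z, pgf a (r y) ≠ 0 :=
    ((ha.analyticAt_pgf hu).continuousAt.tendsto.comp hc).eventually_ne h0
  have h3 : ∀ᶠ y in nhds z, ‖r y‖ < 1 ∧ r y = y * pgf a (r y) := by
    filter_upwards [h1, h2, hinv] with y h1 h2 h3
    exact ⟨h1, (div_eq_iff h2).1 h3⟩
  refine ⟨h3.mono fun y hy => ⟨r y, hy⟩, hra.congr (h3.mono fun y hy => ?_)⟩
  exact (ha.branch_eq hy.1 hy.2).symm

theorem isOpen_fixSet (ha : CriticalLaw a) : IsOpen (fixSet a) :=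
  isOpen_iff_mem_nhds.2 fun _ hz => (ha.fixSet_mem_nhds_and_analyticAt_branch hz).1

theorem exists_fixed_of_mem_closure (ha : CriticalLaw a) {z : ℂ} (hz : z ∈ closure (fixSet a)) :
    ∃ u : ℂ, ‖u‖ ≤ 1 ∧ u = z * pgf a u := by
  obtain ⟨w, hw, hlim⟩ := mem_closure_iff_seq_limit.1 hz
  choose v hv hfix using hw
  obtain ⟨u, hu, φ, hφ, hvlim⟩ := (isCompact_closedBall (0 : ℂ) 1).tendsto_subseq
    (x := v) fun n => mem_closedBall_zero_iff.2 (hv n).le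
  refine ⟨u, mem_closedBall_zero_iff.1 hu, tendsto_nhds_unique hvlim ?_⟩
  have h1 : Tendsto (fun n => pgf a (v (φ n))) atTop (nhds (pgf a u)) :=
    (ha.continuousOn_pgf u hu).tendsto.comp (tendsto_nhdsWithin_iff.2
      ⟨hvlim, Eventually.of_forall fun n => mem_closedBall_zero_iff.2 (hv _).le⟩)
  exact ((hlim.comp hφ.tendsto_atTop).mul h1).congr fun n => (hfix (φ n)).symm

theorem exists_bound_of_far (ha : CriticalLaw a) {ε : ℝ} (hε : 0 < ε) :
    ∃ η : ℝ, 0 < η ∧ ∀ z u : ℂ, ‖z‖ ≤ 2 → ‖u‖ ≤ 1 → ε ≤ ‖u - 1‖ → u = z * pgf a u →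
      ‖z‖ < 1 + η → ‖u‖ < 1 ∧ ‖z * pgf₁ a u‖ ≤ 1 - η := by
  set S : Set (ℂ × ℂ) := Metric.closedBall 0 2 ×ˢ Metric.closedBall 0 1 with hS
  have hmap : MapsTo Prod.snd S (Metric.closedBall (0 : ℂ) 1) := fun x hx => hx.2
  have hc0 : ContinuousOn (fun x : ℂ × ℂ => x.1 * pgf a x.2) S :=
    continuousOn_fst.mul (ha.continuousOn_pgf.comp continuousOn_snd hmap)
  have hc1 : ContinuousOn (fun x : ℂ × ℂ => x.1 * pgf₁ a x.2) S :=
    continuousOn_fst.mul (ha.continuousOn_pgf₁.comp continuousOn_snd hmap)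
  have hScpt : IsCompact S := (isCompact_closedBall _ _).prod (isCompact_closedBall _ _)
  set K : Set (ℂ × ℂ) := (S ∩ (fun x : ℂ × ℂ => x.2 - x.1 * pgf a x.2) ⁻¹' {0}) ∩
    {x | ε ≤ ‖x.2 - 1‖} with hK
  have hKcpt : IsCompact K :=
    (hScpt.of_isClosed_subset ((continuousOn_snd.sub hc0).preimage_isClosed_of_isClosed
      hScpt.isClosed isClosed_singleton) inter_subset_left).inter_right
      (isClosed_le continuous_const (by fun_prop))
  have hKS : K ⊆ S := fun x hx => hx.1.1
  obtain ⟨η, hη, hmin⟩ := hKcpt.exists_forall_le' (a := (0 : ℝ))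
    (f := fun x : ℂ × ℂ => max (‖x.1‖ - 1) (1 - max ‖x.2‖ ‖x.1 * pgf₁ a x.2‖))
    (((continuous_fst.norm.sub continuous_const).continuousOn).sup
      (continuousOn_const.sub (continuous_snd.norm.continuousOn.sup (hc1.mono hKS).norm))) (by
      rintro ⟨z, u⟩ ⟨⟨⟨hz, hu⟩, hfix⟩, hfar⟩
      simp only [mem_closedBall_zero_iff, mem_preimage, mem_singleton_iff, sub_eq_zero,
        mem_ofPred_eq] at hz hu hfix hfar
      by_contra! hle
      obtain ⟨hz1, hmx⟩ := max_le_iff.1 hle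
      have hz1 : ‖z‖ ≤ 1 := by simpa using hz1
      have hulow : ¬ ‖u‖ = 1 := fun hu1 => by
        have h1 : 1 ≤ ‖pgf a u‖ := by
          have : ‖u‖ = ‖z‖ * ‖pgf a u‖ := by rw [← norm_mul, ← hfix]
          nlinarith [norm_nonneg (pgf a u)]
        rw [ha.eq_one_of_norm_pgf hu1 h1] at hfar
        simp at hfar
        linarith
      have hu' : ‖u‖ < 1 := lt_of_le_of_ne hu hulow
      have hw : ‖z * pgf₁ a u‖ < 1 := by
        rw [norm_mul]
        nlinarith [norm_nonneg (pgf₁ a u), ha.norm_pgf₁_lt_one hu']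
      have := max_lt hu' hw
      linarith)
  refine ⟨η, hη, fun z u hz hu hfar hfix hz1 => ?_⟩
  have hmem : (z, u) ∈ K :=
    ⟨⟨⟨mem_closedBall_zero_iff.2 hz, mem_closedBall_zero_iff.2 hu⟩, sub_eq_zero.2 hfix⟩, hfar⟩
  have h := hmin _ hmem
  simp only at h
  rcases le_max_iff.1 h with h | h
  · linarith
  · have h1 := le_max_left ‖u‖ ‖z * pgf₁ a u‖
    have h2 := le_max_right ‖u‖ ‖z * pgf₁ a u‖
    exact ⟨by linarith, by linarith⟩

/-- `(1 - z) / (1 - u)²` along the curve `u = z Φ(u)`. -/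
noncomputable def ratioSq (a : ℕ → ℝ) (u : ℂ) : ℂ := pgfQuot a u / pgf a u

/-- `(1 - z Φ'(u)) / (1 - u)` along the curve `u = z Φ(u)`. -/
noncomputable def ratioLin (a : ℕ → ℝ) (u : ℂ) : ℂ :=
  (1 - u) * ratioSq a u + u / pgf a u * pgfQuot₁ a u

theorem one_sub_eq_of_fixed (ha : CriticalLaw a) {z u : ℂ} (hu : ‖u‖ ≤ 1) (h : u = z * pgf a u) :
    1 - z = (1 - u) ^ 2 * ratioSq a u := by
  have h0 := ha.pgf_ne_zero_of_fixed h
  rw [ratioSq, mul_div_assoc', eq_div_iff h0]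
  linear_combination ha.pgf_eq hu + h

theorem one_sub_mul_eq_of_fixed (ha : CriticalLaw a) {z u : ℂ} (hu : ‖u‖ ≤ 1)
    (h : u = z * pgf a u) : 1 - z * pgf₁ a u = (1 - u) * ratioLin a u := by
  have h0 := ha.pgf_ne_zero_of_fixed h
  have hz : u / pgf a u = z := by rw [div_eq_iff h0]; exact h
  rw [ratioLin, hz, ha.pgf₁_eq hu]
  linear_combination ha.one_sub_eq_of_fixed hu h

theorem exists_near (ha : CriticalLaw a) : ∃ ε : ℝ, 0 < ε ∧ ε * (3 * halfVar a) ≤ 1 / 240 ∧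
    ∀ u : ℂ, ‖u‖ ≤ 1 → ‖u - 1‖ < ε → ‖ratioSq a u - halfVar a‖ ≤ halfVar a / 5 ∧
      ‖u * ratioSq a u - halfVar a‖ ≤ halfVar a / 4 ∧
      ‖ratioLin a u - 2 * halfVar a‖ ≤ halfVar a / 20 := by
  have hq := ha.halfVar_pos
  set q := halfVar a with hqd
  set D := Metric.closedBall (0 : ℂ) 1
  have h1 : (1 : ℂ) ∈ D := by simp [D]
  have hc : ContinuousWithinAt (pgf a) D 1 := ha.continuousOn_pgf 1 h1
  have hB : ContinuousWithinAt (ratioSq a) D 1 :=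
    (ha.continuousOn_pgfQuot 1 h1).div hc (by rw [ha.pgf_one]; exact one_ne_zero)
  have hM : ContinuousWithinAt (ratioLin a) D 1 :=
    ((continuousWithinAt_const.sub continuousWithinAt_id).mul hB).add
      ((continuousWithinAt_id.div hc (by rw [ha.pgf_one]; exact one_ne_zero)).mul
        (ha.continuousOn_pgfQuot₁ 1 h1))
  have hB1 : ratioSq a 1 = q := by rw [ratioSq, ha.pgf_one, pgfQuot_one, div_one]
  have hM1 : ratioLin a 1 = 2 * q := by rw [ratioLin, ha.pgf_one, pgfQuot₁_one]; simp [hqd]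
  have e1 : ∀ᶠ u in nhdsWithin 1 D, ‖ratioSq a u - q‖ < q / 5 := by
    have := Metric.tendsto_nhds.1 hB.tendsto (q / 5) (by positivity)
    simpa [hB1, dist_eq_norm] using this
  have e2 : ∀ᶠ u in nhdsWithin 1 D, ‖u * ratioSq a u - q‖ < q / 4 := by
    have := Metric.tendsto_nhds.1 (continuousWithinAt_id.mul hB).tendsto (q / 4) (by positivity)
    simpa [hB1, dist_eq_norm] using this
  have e3 : ∀ᶠ u in nhdsWithin 1 D, ‖ratioLin a u - 2 * q‖ < q / 20 := by
    have := Metric.tendsto_nhds.1 hM.tendsto (q / 20) (by positivity)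
    simpa [hM1, dist_eq_norm] using this
  obtain ⟨ε, hε, h⟩ := Metric.mem_nhdsWithin_iff.1 (e1.and (e2.and e3))
  refine ⟨min ε (1 / (720 * q)), by positivity, ?_, fun u hu hu1 => ?_⟩
  · calc _ ≤ 1 / (720 * q) * (3 * q) := by gcongr; exact min_le_right _ _
      _ = 1 / 240 := by field_simp; norm_num
  · obtain ⟨h1, h2, h3⟩ := h ⟨by
      rw [Metric.mem_ball, dist_eq_norm]; exact hu1.trans_le (min_le_left _ _),
      mem_closedBall_zero_iff.2 hu⟩
    exact ⟨h1.le, h2.le, h3.le⟩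

end CriticalLaw

theorem mem_Delta_arcsin_iff {δ : ℝ} {z : ℂ} :
    z ∈ Delta (Real.arcsin (1 / 4)) δ ↔ ‖z‖ < 1 + δ ∧ (z - 1).re < 1 / 4 * ‖z - 1‖ := by
  have hb0 : 0 ≤ Real.arcsin (1 / 4) := Real.arcsin_nonneg.2 (by norm_num)
  have hb1 := Real.arcsin_le_pi_div_two (1 / 4)
  have hpi := Real.pi_pos
  have key : z ≠ 1 → (Real.pi / 2 - Real.arcsin (1 / 4) < |Complex.arg (z - 1)| ↔
      (z - 1).re < 1 / 4 * ‖z - 1‖) := fun hz => by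
    have hn : 0 < ‖z - 1‖ := norm_pos_iff.2 (sub_ne_zero.2 hz)
    rw [← Real.strictAntiOn_cos.lt_iff_gt ⟨abs_nonneg _, Complex.abs_arg_le_pi _⟩
      ⟨by linarith, by linarith⟩, Real.cos_abs, Real.cos_pi_div_two_sub,
      Real.sin_arcsin (by norm_num) (by norm_num), ← Complex.norm_mul_cos_arg (z - 1),
      mul_comm (1 / 4 : ℝ), mul_lt_mul_iff_right₀ hn]
  constructor
  · rintro ⟨h1, h2, h3⟩
    exact ⟨h1, (key h2).1 h3⟩
  · rintro ⟨h1, h2⟩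
    have hz : z ≠ 1 := by rintro rfl; simp at h2
    exact ⟨h1, hz, (key hz).2 h2⟩

theorem isPreconnected_Delta {δ : ℝ} (hδ : 0 < δ) :
    IsPreconnected (Delta (Real.arcsin (1 / 4)) δ) := by
  have h0 : (0 : ℂ) ∈ Delta (Real.arcsin (1 / 4)) δ := by
    rw [mem_Delta_arcsin_iff]; norm_num; linarith
  refine (StarConvex.isPathConnected (a := (0 : ℂ)) ?_ h0).isConnected.isPreconnected
  rw [starConvex_zero_iff]
  intro z hz t ht0 ht1
  rw [mem_Delta_arcsin_iff] at hz ⊢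
  obtain ⟨hz1, hz2⟩ := hz
  constructor
  · rw [norm_smul, Real.norm_of_nonneg ht0]
    exact (mul_le_of_le_one_left (norm_nonneg _) ht1).trans_lt hz1
  · have e : t • z - 1 = t * (z - 1) - ((1 - t : ℝ) : ℂ) := by
      rw [Complex.real_smul]; push_cast; ring
    have hre : (t • z - 1).re = t * (z - 1).re - (1 - t) := by
      rw [e, Complex.sub_re, Complex.re_ofReal_mul, Complex.ofReal_re]
    have hn : t * ‖z - 1‖ ≤ ‖t • z - 1‖ + (1 - t) := by
      have h1 := norm_add_le (t • z - 1) ((1 - t : ℝ) : ℂ)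
      rw [e, sub_add_cancel, norm_mul, Complex.norm_real, Complex.norm_real,
        Real.norm_of_nonneg ht0, Real.norm_of_nonneg (by linarith)] at h1
      rw [e]; exact h1
    rw [hre]
    rcases ht0.eq_or_lt with rfl | ht
    · have := norm_nonneg ((0 : ℝ) • z - 1); norm_num
    · nlinarith

/-- Two vectors in sectors of total opening less than `π` cannot cancel. -/
theorem norm_le_of_re_bounds {m n : ℂ} (hm : 3 / 8 * ‖m‖ ≤ m.re) (hn : -(1 / 4 * ‖n‖) ≤ n.re) :
    1 / 11 * ‖n‖ ≤ ‖n + m‖ := by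
  have h1 := Complex.re_le_norm (n + m)
  have h2 : ‖n‖ ≤ ‖n + m‖ + ‖m‖ := by simpa using norm_sub_le (n + m) m
  rw [Complex.add_re] at h1
  linarith

theorem re_ge_of_norm_sub_le {E : ℂ} {c r : ℝ} (h : ‖E - c‖ ≤ r) : c - r ≤ E.re := by
  have h1 := Complex.abs_re_le_norm (E - c)
  rw [Complex.sub_re, Complex.ofReal_re] at h1
  linarith [(abs_le.1 (h1.trans h)).1]

theorem norm_le_of_norm_sub_le {E : ℂ} {c r : ℝ} (hc : 0 ≤ c) (h : ‖E - c‖ ≤ r) :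
    ‖E‖ ≤ c + r := by
  have h1 := norm_add_le (E - c) c
  rw [sub_add_cancel, Complex.norm_real, Real.norm_of_nonneg hc] at h1
  linarith

theorem norm_ge_of_norm_sub_le {E : ℂ} {c r : ℝ} (h : ‖E - c‖ ≤ r) : c - r ≤ ‖E‖ :=
  (re_ge_of_norm_sub_le h).trans (Complex.re_le_norm E)

/-- If `s² B` stays away from the negative axis and `B` is nearly a positive constant, then `s`
stays away from the imaginary axis. -/
theorem half_norm_le_re {s B : ℂ} {q : ℝ} (hq : 0 < q) (hB : ‖B - q‖ ≤ q / 5) (hs : 0 ≤ s.re)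
    (h : -(1 / 4 * ‖s ^ 2 * B‖) ≤ (s ^ 2 * B).re) : 1 / 2 * ‖s‖ ≤ s.re := by
  have e : s ^ 2 * B = s ^ 2 * (B - q) + q * s ^ 2 := by ring
  have h1 : (s ^ 2 * B).re ≤ ‖s‖ ^ 2 * (q / 5) + q * (s ^ 2).re := by
    rw [e, Complex.add_re, Complex.re_ofReal_mul]
    have := Complex.re_le_norm (s ^ 2 * (B - q))
    rw [norm_mul, norm_pow] at this
    have := mul_le_mul_of_nonneg_left hB (sq_nonneg ‖s‖)
    linarith
  have h2 : ‖s ^ 2 * B‖ ≤ ‖s‖ ^ 2 * (6 / 5 * q) := by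
    rw [norm_mul, norm_pow]
    have := norm_le_of_norm_sub_le hq.le hB
    gcongr; linarith
  have h3 : (s ^ 2).re = 2 * s.re ^ 2 - ‖s‖ ^ 2 := by
    rw [← Complex.normSq_eq_norm_sq, Complex.normSq_apply, sq, Complex.mul_re]; ring
  rw [h3] at h1
  have h4 : q * (1 / 4 * ‖s‖ ^ 2) ≤ q * s.re ^ 2 := by nlinarith
  have h5 := le_of_mul_le_mul_left h4 hq
  nlinarith [norm_nonneg s]

namespace CriticalLaw

variable {a : ℕ → ℝ}

theorem re_ge_of_fixed_on_circle (ha : CriticalLaw a) {z u : ℂ} (hu : ‖u‖ = 1)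
    (h : u = z * pgf a u) (hB : ‖u * ratioSq a u - halfVar a‖ ≤ halfVar a / 4) :
    1 / 4 * ‖z - 1‖ ≤ (z - 1).re := by
  have hq := ha.halfVar_pos
  have h1 := ha.one_sub_eq_of_fixed hu.le h
  have hconj : u * (starRingEnd ℂ) u = 1 := by
    rw [Complex.mul_conj, Complex.normSq_eq_norm_sq, hu]; norm_num
  have h2 : ((‖1 - u‖ ^ 2 : ℝ) : ℂ) = (1 - u) * (1 - (starRingEnd ℂ) u) := by
    rw [← Complex.normSq_eq_norm_sq, Complex.normSq_eq_conj_mul_self]; simp; ring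
  have h3 : z - 1 = ((‖1 - u‖ ^ 2 : ℝ) : ℂ) * (u * ratioSq a u) := by
    rw [h2]
    linear_combination -h1 + (1 - u) * ratioSq a u * hconj
  rw [h3, Complex.re_ofReal_mul, norm_mul, Complex.norm_real, Real.norm_of_nonneg (by positivity)]
  have h4 := re_ge_of_norm_sub_le hB
  have h5 := norm_le_of_norm_sub_le hq.le hB
  have h6 : 1 / 4 * ‖u * ratioSq a u‖ ≤ (u * ratioSq a u).re := by linarith
  nlinarith [sq_nonneg ‖1 - u‖]

theorem sqrt_norm_le_of_near (ha : CriticalLaw a) {z u : ℂ} (hu : ‖u‖ ≤ 1)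
    (h : u = z * pgf a u) (hB : ‖ratioSq a u - halfVar a‖ ≤ halfVar a / 5)
    (hM : ‖ratioLin a u - 2 * halfVar a‖ ≤ halfVar a / 20) :
    halfVar a / √(2 * halfVar a) * ‖1 - z‖ ^ ((1 : ℝ) / 2) ≤ ‖1 - z * pgf₁ a u‖ := by
  have hq := ha.halfVar_pos
  rw [ha.one_sub_mul_eq_of_fixed hu h, ha.one_sub_eq_of_fixed hu h, ← Real.sqrt_eq_rpow, norm_mul,
    norm_mul, norm_pow, Real.sqrt_mul (sq_nonneg ‖1 - u‖), Real.sqrt_sq (norm_nonneg _)]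
  have hM' : ‖ratioLin a u - ((2 * halfVar a : ℝ) : ℂ)‖ ≤ halfVar a / 20 := by
    push_cast; exact hM
  have h1 := norm_ge_of_norm_sub_le hM'
  have h2 : √‖ratioSq a u‖ ≤ √(2 * halfVar a) :=
    Real.sqrt_le_sqrt (by linarith [norm_le_of_norm_sub_le hq.le hB])
  calc halfVar a / √(2 * halfVar a) * (‖1 - u‖ * √‖ratioSq a u‖)
      ≤ halfVar a / √(2 * halfVar a) * (‖1 - u‖ * √(2 * halfVar a)) := by gcongr
    _ = ‖1 - u‖ * halfVar a := by
        have : √(2 * halfVar a) ≠ 0 := by positivity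
        field_simp
    _ ≤ ‖1 - u‖ * ‖ratioLin a u‖ := by gcongr; linarith

theorem norm_one_sub_mul_ge_of_near (ha : CriticalLaw a) {z u x : ℂ} (hu : ‖u‖ ≤ 1)
    (h : u = z * pgf a u) (hε : ‖1 - u‖ * (3 * halfVar a) ≤ 1 / 240)
    (hB : ‖ratioSq a u - halfVar a‖ ≤ halfVar a / 5)
    (hM : ‖ratioLin a u - 2 * halfVar a‖ ≤ halfVar a / 20)
    (hz : -(1 / 4 * ‖1 - z‖) ≤ (1 - z).re) (hx : -(1 / 4 * ‖1 - x‖) ≤ (1 - x).re)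
    (hx2 : ‖x‖ ≤ 2) : 1 / 11 * ‖1 - x‖ ≤ ‖1 - x * (z * pgf₁ a u)‖ := by
  have hq := ha.halfVar_pos
  have hw := ha.one_sub_mul_eq_of_fixed hu h
  have hM' : ‖ratioLin a u - ((2 * halfVar a : ℝ) : ℂ)‖ ≤ halfVar a / 20 := by
    push_cast; exact hM
  have hM3 : ‖ratioLin a u‖ ≤ 3 * halfVar a := by
    linarith [norm_le_of_norm_sub_le (by positivity) hM']
  have e : 1 - x * (z * pgf₁ a u) = (1 - x) + (1 - u) * (x * ratioLin a u) := by
    linear_combination x * hw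
  rw [e]
  rcases le_or_gt (1 / 60) ‖1 - x‖ with hfar | hnear
  · have h1 : ‖(1 - u) * (x * ratioLin a u)‖ ≤ 1 / 120 := by
      rw [norm_mul, norm_mul]
      calc ‖1 - u‖ * (‖x‖ * ‖ratioLin a u‖) ≤ ‖1 - u‖ * (2 * (3 * halfVar a)) := by gcongr
        _ ≤ 1 / 120 := by linarith
    have h2 : ‖1 - x‖ ≤ ‖(1 - x) + (1 - u) * (x * ratioLin a u)‖
        + ‖(1 - u) * (x * ratioLin a u)‖ := by
      simpa using norm_sub_le ((1 - x) + (1 - u) * (x * ratioLin a u))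
        ((1 - u) * (x * ratioLin a u))
    linarith
  · refine norm_le_of_re_bounds ?_ hx
    have hs : 1 / 2 * ‖1 - u‖ ≤ (1 - u).re := by
      refine half_norm_le_re hq hB ?_ ?_
      · have := (Complex.re_le_norm u).trans hu
        simp; linarith
      · rw [← ha.one_sub_eq_of_fixed hu h]; exact hz
    have hxM : ‖x * ratioLin a u - ((2 * halfVar a : ℝ) : ℂ)‖ ≤ halfVar a / 10 := by
      have e2 : x * ratioLin a u - ((2 * halfVar a : ℝ) : ℂ) =
          (ratioLin a u - ((2 * halfVar a : ℝ) : ℂ)) - (1 - x) * ratioLin a u := by ring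
      rw [e2]
      refine (norm_sub_le _ _).trans ?_
      rw [norm_mul]
      have : ‖1 - x‖ * ‖ratioLin a u‖ ≤ 1 / 60 * (3 * halfVar a) := by gcongr
      linarith
    set s := 1 - u
    set E := x * ratioLin a u
    have h1 := norm_le_of_norm_sub_le (by positivity) hxM
    have h2 : 2 * halfVar a * s.re - ‖s‖ * (halfVar a / 10) ≤ (s * E).re := by
      have e3 : s * E = ((2 * halfVar a : ℝ) : ℂ) * s + s * (E - ((2 * halfVar a : ℝ) : ℂ)) := by
        ring
      rw [e3, Complex.add_re, Complex.re_ofReal_mul]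
      have h3 := (abs_le.1 (Complex.abs_re_le_norm (s * (E - ((2 * halfVar a : ℝ) : ℂ))))).1
      rw [norm_mul] at h3
      have := mul_le_mul_of_nonneg_left hxM (norm_nonneg s)
      linarith
    have h3 : ‖s * E‖ ≤ ‖s‖ * (2 * halfVar a + halfVar a / 10) := by
      rw [norm_mul]; gcongr
    nlinarith [mul_le_mul_of_nonneg_left hs hq.le, mul_nonneg hq.le (norm_nonneg s)]

theorem neg_le_one_sub_re {δ : ℝ} {z : ℂ} (hz : z ∈ Delta (Real.arcsin (1 / 4)) δ) :
    -(1 / 4 * ‖1 - z‖) ≤ (1 - z).re := by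
  have := (mem_Delta_arcsin_iff.1 hz).2
  have e : (1 - z).re = -(z - 1).re := by simp
  rw [norm_sub_rev, e]
  linarith

/-- The main analytic estimate. -/
theorem exists_Delta_bounds (ha : CriticalLaw a) : ∃ δ c : ℝ, 0 < δ ∧ δ ≤ 1 ∧ 0 < c ∧
    Delta (Real.arcsin (1 / 4)) δ ⊆ fixSet a ∧ ∀ z ∈ Delta (Real.arcsin (1 / 4)) δ,
      c * ‖1 - z‖ ^ ((1 : ℝ) / 2) ≤ ‖1 - z * pgf₁ a (branch a z)‖ ∧
      ∀ x ∈ Delta (Real.arcsin (1 / 4)) δ,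
        c * ‖1 - x‖ ≤ ‖1 - x * (z * pgf₁ a (branch a z))‖ := by
  obtain ⟨ε, hε, hεq, hnear⟩ := ha.exists_near
  obtain ⟨η, hη, hfar⟩ := ha.exists_bound_of_far hε
  have hq := ha.halfVar_pos
  set δ := min (η / 2) 1 with hδ
  have hδ0 : 0 < δ := by positivity
  have hδ1 : δ ≤ 1 := min_le_right _ _
  have hδη : δ ≤ η / 2 := min_le_left _ _
  have hsub : Delta (Real.arcsin (1 / 4)) δ ⊆ fixSet a := by
    refine (isPreconnected_Delta hδ0).subset_of_closure_inter_subset ha.isOpen_fixSet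
      ⟨0, ?_, 0, by simp, by simp⟩ ?_
    · rw [mem_Delta_arcsin_iff]; norm_num; linarith
    · rintro z ⟨hcl, hz⟩
      obtain ⟨u, hu, hfix⟩ := ha.exists_fixed_of_mem_closure hcl
      refine ⟨u, lt_of_le_of_ne hu fun hu1 => ?_, hfix⟩
      obtain ⟨hz1, hz2⟩ := mem_Delta_arcsin_iff.1 hz
      rcases lt_or_ge ‖u - 1‖ ε with hlt | hge
      · exact absurd (ha.re_ge_of_fixed_on_circle hu1 hfix (hnear u hu hlt).2.1) (not_le.2 hz2)
      · exact (hfar z u (by linarith) hu hge hfix (by linarith)).1.ne hu1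
  have hlen : ∀ z ∈ Delta (Real.arcsin (1 / 4)) δ, ‖z‖ ≤ 2 ∧ ‖1 - z‖ ≤ 3 := fun z hz => by
    have h1 := (mem_Delta_arcsin_iff.1 hz).1
    have h2 := norm_sub_le 1 z
    rw [norm_one] at h2
    exact ⟨by linarith, by linarith⟩
  refine ⟨δ, min (1 / 11) (min (η / 6) (halfVar a / √(2 * halfVar a))), hδ0, hδ1, by positivity,
    hsub, fun z hz => ?_⟩
  set c := min (1 / 11) (min (η / 6) (halfVar a / √(2 * halfVar a)))
  have hc1 : c ≤ 1 / 11 := min_le_left _ _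
  have hc2 : c ≤ η / 6 := (min_le_right _ _).trans (min_le_left _ _)
  have hc3 : c ≤ halfVar a / √(2 * halfVar a) := (min_le_right _ _).trans (min_le_right _ _)
  have hu := (norm_branch_lt (hsub hz)).le
  have hfix := branch_eq_mul (hsub hz)
  set u := branch a z
  rcases lt_or_ge ‖u - 1‖ ε with hlt | hge
  · obtain ⟨hB, -, hM⟩ := hnear u hu hlt
    refine ⟨le_trans ?_ (ha.sqrt_norm_le_of_near hu hfix hB hM), fun x hx => le_trans ?_
      (ha.norm_one_sub_mul_ge_of_near hu hfix ?_ hB hM (neg_le_one_sub_re hz)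
        (neg_le_one_sub_re hx) (hlen x hx).1)⟩
    · gcongr
    · gcongr
    · rw [norm_sub_rev]
      exact (mul_le_mul_of_nonneg_right hlt.le (by positivity)).trans hεq
  · have hw := (hfar z u (hlen z hz).1 hu hge hfix
      (by linarith [(mem_Delta_arcsin_iff.1 hz).1])).2
    set w := z * pgf₁ a u
    constructor
    · have h1 : η ≤ ‖1 - w‖ := by
        have := norm_sub_norm_le (1 : ℂ) w
        rw [norm_one] at this; linarith
      have h2 : ‖1 - z‖ ^ ((1 : ℝ) / 2) ≤ 2 := by
        rw [← Real.sqrt_eq_rpow]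
        exact Real.sqrt_le_iff.2 ⟨by norm_num, by linarith [(hlen z hz).2]⟩
      calc _ ≤ η / 6 * 2 := by gcongr
        _ ≤ _ := by linarith
    · intro x hx
      have hx1 := (mem_Delta_arcsin_iff.1 hx).1
      have h1 : ‖x * w‖ ≤ 1 - η / 2 := by
        rw [norm_mul]
        calc ‖x‖ * ‖w‖ ≤ (1 + η / 2) * (1 - η) := by gcongr; linarith
          _ ≤ 1 - η / 2 := by nlinarith
      have h2 := norm_sub_norm_le (1 : ℂ) (x * w)
      rw [norm_one] at h2
      calc _ ≤ η / 6 * 3 := by gcongr; exact (hlen x hx).2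
        _ ≤ _ := by linarith

end CriticalLaw

namespace PlaneTree

theorem induction_children {P : PlaneTree → Prop}
    (h : ∀ ts : List PlaneTree, (∀ t ∈ ts, P t) → P (node ts)) : ∀ t, P t
  | .node ts => h ts fun t _ => induction_children h t

/-- The tree whose root has `n` subtrees, given by a tuple. -/
def graft {n : ℕ} (f : Fin n → PlaneTree) : PlaneTree := node (List.ofFn f)

/-- A tree is the tuple of the subtrees of its root. -/
def graftEquiv : (Σ n, Fin n → PlaneTree) ≃ PlaneTree :=
  (List.equivSigmaTuple (α := PlaneTree)).symm.trans
    ⟨node, children, fun _ => rfl, fun t => by cases t; rfl⟩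

theorem graftEquiv_apply (x : Σ n, Fin n → PlaneTree) : graftEquiv x = graft x.2 := rfl

theorem induction_graft {P : PlaneTree → Prop}
    (h : ∀ (n : ℕ) (f : Fin n → PlaneTree), (∀ i, P (f i)) → P (graft f)) (t : PlaneTree) : P t := by
  refine induction_children (fun ts hts => ?_) t
  have := h ts.length ts.get fun i => hts _ (List.get_mem _ _)
  rwa [graft, List.ofFn_get] at this

theorem subtreeAt_nil (t : PlaneTree) : subtreeAt t [] = some t := by cases t; rfl

theorem subtreeAt_graft_cons {n : ℕ} (f : Fin n → PlaneTree) (i : Fin n) (q : List ℕ) :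
    subtreeAt (graft f) (i :: q) = subtreeAt (f i) q := by
  rw [graft, subtreeAt]
  have : (List.ofFn f)[(i : ℕ)]? = some (f i) := by simp
  rw [this]

theorem subtreeAt_graft_cons_of_le {n : ℕ} (f : Fin n → PlaneTree) {i : ℕ} (hi : n ≤ i)
    (q : List ℕ) : subtreeAt (graft f) (i :: q) = none := by
  rw [graft, subtreeAt]
  have : (List.ofFn f)[i]? = none := by simp [hi]
  rw [this]

theorem vertexSet_graft {n : ℕ} (f : Fin n → PlaneTree) :
    vertexSet (graft f) = insert [] (⋃ i : Fin n, List.cons (i : ℕ) '' vertexSet (f i)) := by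
  ext q
  rcases q with _ | ⟨j, q⟩
  · simp [vertexSet, subtreeAt_nil]
  · simp only [vertexSet, mem_ofPred_eq, mem_insert_iff, reduceCtorEq, mem_iUnion, mem_image,
      List.cons.injEq, false_or]
    constructor
    · intro h
      rcases lt_or_ge j n with hj | hj
      · refine ⟨⟨j, hj⟩, q, ?_, rfl, rfl⟩
        exact (subtreeAt_graft_cons f ⟨j, hj⟩ q) ▸ h
      · rw [subtreeAt_graft_cons_of_le f hj] at h; simp at h
    · rintro ⟨i, q', h, rfl, rfl⟩
      rwa [subtreeAt_graft_cons]

theorem vertexSet_finite (t : PlaneTree) : (vertexSet t).Finite := by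
  induction t using induction_graft with
  | h n f ih =>
    rw [vertexSet_graft]
    exact (finite_iUnion fun i => (ih i).image _).insert _

@[to_additive]
theorem finprod_vertexSet_graft {M : Type*} [CommMonoid M] {n : ℕ} (f : Fin n → PlaneTree)
    (g : List ℕ → M) : ∏ᶠ v ∈ vertexSet (graft f), g v =
      g [] * ∏ i : Fin n, ∏ᶠ v ∈ vertexSet (f i), g ((i : ℕ) :: v) := by
  have hfin : ∀ i : Fin n, (List.cons (i : ℕ) '' vertexSet (f i)).Finite :=
    fun i => (vertexSet_finite _).image _
  rw [vertexSet_graft, finprod_mem_insert _ (by simp) (finite_iUnion hfin),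
    finprod_mem_iUnion _ hfin, finprod_eq_prod_of_fintype]
  · congr 1
    refine Finset.prod_congr rfl fun i _ => ?_
    exact finprod_mem_image (List.cons_injective.injOn)
  · intro i j hij
    rw [Function.onFun, Set.disjoint_left]
    rintro _ ⟨v, _, rfl⟩ ⟨w, _, h⟩
    exact hij (Fin.ext (List.cons.inj h).1.symm)

theorem size_eq_finsum (t : PlaneTree) : size t = ∑ᶠ _v ∈ vertexSet t, 1 := by
  rw [finsum_mem_eq_finite_toFinset_sum _ (vertexSet_finite t), size,
    Set.ncard_eq_toFinset_card _ (vertexSet_finite t), Finset.card_eq_sum_ones]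

theorem size_graft {n : ℕ} (f : Fin n → PlaneTree) : size (graft f) = 1 + ∑ i, size (f i) := by
  simp only [size_eq_finsum, finsum_vertexSet_graft]

theorem one_le_size (t : PlaneTree) : 1 ≤ size t := by
  induction t using induction_graft with
  | h n f ih => rw [size_graft]; omega

theorem gwProb_graft (p : ℕ → ℝ≥0∞) {n : ℕ} (f : Fin n → PlaneTree) :
    gwProb p (graft f) = p n * ∏ i, gwProb p (f i) := by
  rw [gwProb, finprod_vertexSet_graft]
  congr 1
  · simp [childCount, subtreeAt_nil, graft, children]
  · refine Finset.prod_congr rfl fun i _ => ?_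
    simp only [gwProb, childCount, subtreeAt_graft_cons]

/-- `∑_{v} x^{d(v, o)}`. -/
noncomputable def depthSum (x : ℂ) (t : PlaneTree) : ℂ := ∑ᶠ v ∈ vertexSet t, x ^ v.length

/-- `∑_{v, w} x^{d(v, v ∧ w)} y^{d(w, v ∧ w)}`. -/
noncomputable def pairSum (x y : ℂ) (t : PlaneTree) : ℂ :=
  ∑ᶠ v ∈ vertexSet t, ∑ᶠ w ∈ vertexSet t, x ^ dUp v w * y ^ dUp w v

theorem mul_finsum_vertexSet (t : PlaneTree) (c : ℂ) (g : List ℕ → ℂ) :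
    ∑ᶠ v ∈ vertexSet t, c * g v = c * ∑ᶠ v ∈ vertexSet t, g v :=
  (mul_finsum_mem g c).symm

theorem depthSum_graft (x : ℂ) {n : ℕ} (f : Fin n → PlaneTree) :
    depthSum x (graft f) = 1 + x * ∑ i, depthSum x (f i) := by
  rw [depthSum, finsum_vertexSet_graft, Finset.mul_sum]
  simp only [List.length_nil, pow_zero, List.length_cons, pow_succ', mul_finsum_vertexSet, depthSum]

theorem dUp_nil_left (w : List ℕ) : dUp [] w = 0 := by simp [dUp]

theorem dUp_nil_right (v : List ℕ) : dUp v [] = v.length := by cases v <;> simp [dUp, lca]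

theorem dUp_cons_self (i : ℕ) (v w : List ℕ) : dUp (i :: v) (i :: w) = dUp v w := by
  simp [dUp, lca]

theorem dUp_cons_of_ne {i j : ℕ} (h : i ≠ j) (v w : List ℕ) :
    dUp (i :: v) (j :: w) = v.length + 1 := by
  simp [dUp, lca, h]

theorem pairSum_graft (x y : ℂ) {n : ℕ} (f : Fin n → PlaneTree) :
    pairSum x y (graft f) = 1 + x * (∑ i, depthSum x (f i)) + y * (∑ i, depthSum y (f i))
      + ∑ i, (pairSum x y (f i) - x * y * (depthSum x (f i) * depthSum y (f i)))
      + x * y * ((∑ i, depthSum x (f i)) * ∑ i, depthSum y (f i)) := by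
  have hinner : ∀ (i : Fin n) (v : List ℕ),
      ∑ᶠ w ∈ vertexSet (graft f), x ^ dUp ((i : ℕ) :: v) w * y ^ dUp w ((i : ℕ) :: v)
        = x * x ^ v.length + ((∑ᶠ w ∈ vertexSet (f i), x ^ dUp v w * y ^ dUp w v)
          + (x * y * (∑ j, depthSum y (f j) - depthSum y (f i))) * x ^ v.length) := by
    intro i v
    rw [finsum_vertexSet_graft, dUp_nil_left, dUp_nil_right, List.length_cons, pow_zero, mul_one,
      pow_succ']
    congr 1
    rw [← Finset.add_sum_erase _ _ (Finset.mem_univ i), ← Finset.sum_erase_eq_sub (Finset.mem_univ i)]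
    simp only [dUp_cons_self]
    congr 1
    rw [Finset.mul_sum, Finset.sum_mul]
    refine Finset.sum_congr rfl fun j hj => ?_
    have hne : (i : ℕ) ≠ j := fun h => (Finset.ne_of_mem_erase hj) (Fin.ext h.symm)
    simp only [dUp_cons_of_ne hne, dUp_cons_of_ne hne.symm, mul_finsum_vertexSet, pow_succ',
      depthSum]
    ring
  have hroot : ∑ᶠ w ∈ vertexSet (graft f), x ^ dUp [] w * y ^ dUp w [] = depthSum y (graft f) := by
    simp only [dUp_nil_left, dUp_nil_right, pow_zero, one_mul, depthSum]
  have houter : ∀ i : Fin n, ∑ᶠ v ∈ vertexSet (f i), (x * x ^ v.length +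
      ((∑ᶠ w ∈ vertexSet (f i), x ^ dUp v w * y ^ dUp w v)
          + (x * y * (∑ j, depthSum y (f j) - depthSum y (f i))) * x ^ v.length))
      = x * depthSum x (f i) + (pairSum x y (f i) +
        (x * y * (∑ j, depthSum y (f j) - depthSum y (f i))) * depthSum x (f i)) := by
    intro i
    rw [finsum_mem_add_distrib (vertexSet_finite _), finsum_mem_add_distrib (vertexSet_finite _),
      mul_finsum_vertexSet, mul_finsum_vertexSet]
    rfl
  rw [pairSum, finsum_vertexSet_graft, hroot, depthSum_graft]
  simp only [hinner, houter]
  simp only [Finset.sum_add_distrib, Finset.sum_sub_distrib, ← Finset.mul_sum]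
  have e : ∑ i, x * y * (∑ j, depthSum y (f j) - depthSum y (f i)) * depthSum x (f i)
      = x * y * ((∑ i, depthSum x (f i)) * ∑ i, depthSum y (f i))
        - x * y * ∑ i, depthSum x (f i) * depthSum y (f i) := by
    rw [Finset.sum_mul, ← mul_sub, ← Finset.sum_sub_distrib, Finset.mul_sum]
    exact Finset.sum_congr rfl fun i _ => by ring
  rw [e]
  ring

theorem norm_finsum_vertexSet_le (t : PlaneTree) {g : List ℕ → ℂ} {c : ℝ} (hg : ∀ v, ‖g v‖ ≤ c) :
    ‖∑ᶠ v ∈ vertexSet t, g v‖ ≤ size t * c := by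
  rw [finsum_mem_eq_finite_toFinset_sum _ (vertexSet_finite t)]
  refine (norm_sum_le_of_le _ fun v _ => hg v).trans (le_of_eq ?_)
  rw [Finset.sum_const, nsmul_eq_mul, size, Set.ncard_eq_toFinset_card _ (vertexSet_finite t)]

theorem norm_depthSum_le {x : ℂ} (hx : ‖x‖ ≤ 1) (t : PlaneTree) : ‖depthSum x t‖ ≤ size t := by
  simpa [depthSum] using norm_finsum_vertexSet_le t fun v => CriticalLaw.norm_pow_le_one hx v.length

theorem norm_pairSum_le {x y : ℂ} (hx : ‖x‖ ≤ 1) (hy : ‖y‖ ≤ 1) (t : PlaneTree) :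
    ‖pairSum x y t‖ ≤ (size t : ℝ) ^ 2 := by
  rw [sq]
  refine norm_finsum_vertexSet_le t fun v => ?_
  have : ∀ w, ‖x ^ dUp v w * y ^ dUp w v‖ ≤ 1 := fun w => by
    rw [norm_mul]
    exact mul_le_one₀ (CriticalLaw.norm_pow_le_one hx _) (norm_nonneg _)
      (CriticalLaw.norm_pow_le_one hy _)
  simpa using norm_finsum_vertexSet_le t this

theorem tsum_pi_prod_eq_pow (b : PlaneTree → ℝ≥0∞) (n : ℕ) :
    ∑' f : Fin n → PlaneTree, ∏ i, b (f i) = (∑' t, b t) ^ n := by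
  induction n with
  | zero => simp
  | succ n ih =>
    rw [← (Fin.consEquiv fun _ => PlaneTree).tsum_eq, ENNReal.tsum_prod', pow_succ', ← ih,
      ← ENNReal.tsum_mul_right]
    refine tsum_congr fun t => ?_
    rw [← ENNReal.tsum_mul_left]
    refine tsum_congr fun f => ?_
    simp [Fin.consEquiv, Fin.prod_univ_succ]

/-- Trees of height less than `h`. -/
def heightLT : ℕ → PlaneTree → Prop
  | 0, _ => False
  | h + 1, t => ∀ s ∈ t.children, heightLT h s

theorem heightLT_graft {h n : ℕ} (f : Fin n → PlaneTree) :
    heightLT (h + 1) (graft f) ↔ ∀ i, heightLT h (f i) := by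
  simp [heightLT, graft, children, List.mem_ofFn]

theorem heightLT_mono {h : ℕ} : ∀ {k : ℕ} {t : PlaneTree}, h ≤ k → heightLT h t → heightLT k t := by
  induction h with
  | zero => intro k t _ ht; exact ht.elim
  | succ h ih =>
    intro k t hk ht
    obtain ⟨k, rfl⟩ : ∃ m, k = m + 1 := ⟨k - 1, by omega⟩
    exact fun s hs => ih (by omega) (ht s hs)

theorem exists_heightLT (t : PlaneTree) : ∃ h, heightLT h t := by
  induction t using induction_graft with
  | h n f ih =>
    choose k hk using ih
    refine ⟨Finset.univ.sup k + 1, (heightLT_graft f).2 fun i => ?_⟩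
    exact heightLT_mono (Finset.le_sup (Finset.mem_univ i)) (hk i)

open Classical in
theorem tsum_heightLT_le_one {p : ℕ → ℝ≥0∞} (hp : ∑' k, p k = 1) (h : ℕ) :
    ∑' t, (if heightLT h t then gwProb p t else 0) ≤ 1 := by
  induction h with
  | zero => simp [heightLT]
  | succ h ih =>
    rw [← graftEquiv.tsum_eq, ENNReal.tsum_sigma', ← hp]
    refine ENNReal.tsum_le_tsum fun n => ?_
    calc ∑' f : Fin n → PlaneTree,
          (if heightLT (h + 1) (graftEquiv ⟨n, f⟩) then gwProb p (graftEquiv ⟨n, f⟩) else 0)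
        = ∑' f : Fin n → PlaneTree, p n * ∏ i, (if heightLT h (f i) then gwProb p (f i) else 0) := by
          refine tsum_congr fun f => ?_
          simp only [graftEquiv_apply, heightLT_graft, gwProb_graft]
          split_ifs with hf
          · simp [hf]
          · push Not at hf
            obtain ⟨i, hi⟩ := hf
            rw [Finset.prod_eq_zero (Finset.mem_univ i) (by simp [hi]), mul_zero]
      _ = p n * (∑' t, (if heightLT h t then gwProb p t else 0)) ^ n := by
          rw [ENNReal.tsum_mul_left,
            tsum_pi_prod_eq_pow fun t => if heightLT h t then gwProb p t else 0]
      _ ≤ p n := mul_le_of_le_one_right' (pow_le_one' ih n)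

theorem tsum_gwProb_le_one {p : ℕ → ℝ≥0∞} (hp : ∑' k, p k = 1) : ∑' t, gwProb p t ≤ 1 := by
  classical
  refine ENNReal.summable.tsum_le_of_sum_le fun s => ?_
  choose k hk using exists_heightLT
  refine le_trans ?_ (tsum_heightLT_le_one hp (s.sup k))
  refine le_trans (le_of_eq (Finset.sum_congr rfl fun t ht => ?_)) (ENNReal.sum_le_tsum s)
  rw [if_pos (heightLT_mono (Finset.le_sup ht) (hk t))]

end PlaneTree

section PiSums

variable {T : Type*} {w c d : T → ℂ} {F A B D : ℂ}

theorem HasSum.mul_prod_complex {ι κ : Type*} {f : ι → ℂ} {g : κ → ℂ} {s t : ℂ} (hf : HasSum f s)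
    (hg : HasSum g t) : HasSum (fun x : ι × κ => f x.1 * g x.2) (s * t) :=
  hf.mul hg (summable_mul_of_summable_norm hf.summable.norm hg.summable.norm)

theorem hasSum_pi_prod (hw : HasSum w F) (n : ℕ) :
    HasSum (fun f : Fin n → T => ∏ i, w (f i)) (F ^ n) := by
  induction n with
  | zero => simp
  | succ n ih =>
    rw [← (Fin.consEquiv fun _ => T).hasSum_iff]
    refine CriticalLaw.hasSum_of_eq (hw.mul_prod_complex ih) (fun f => ?_) (pow_succ' _ _)
    simp [Fin.consEquiv, Fin.prod_univ_succ]

theorem hasSum_pi_prod_mul_sum (hw : HasSum w F) (hc : HasSum (fun t => w t * c t) A) (n : ℕ) :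
    HasSum (fun f : Fin n → T => (∏ i, w (f i)) * ∑ i, c (f i)) (n * F ^ (n - 1) * A) := by
  induction n with
  | zero => simp
  | succ n ih =>
    rw [← (Fin.consEquiv fun _ => T).hasSum_iff]
    refine CriticalLaw.hasSum_of_eq ((hc.mul_prod_complex (hasSum_pi_prod hw n)).add
      (hw.mul_prod_complex ih)) (fun f => ?_) ?_
    · simp only [Fin.consEquiv, Fin.prod_univ_succ, Fin.sum_univ_succ, Function.comp_apply,
        Equiv.coe_fn_mk, Fin.cons_zero, Fin.cons_succ]
      ring
    · rcases n with _ | n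
      · simp
      · simp only [Nat.add_sub_cancel]
        push_cast
        ring

theorem hasSum_pi_prod_mul_sum_mul_sum (hw : HasSum w F) (hc : HasSum (fun t => w t * c t) A)
    (hd : HasSum (fun t => w t * d t) B) (hcd : HasSum (fun t => w t * (c t * d t)) D) (n : ℕ) :
    HasSum (fun f : Fin n → T => (∏ i, w (f i)) * ((∑ i, c (f i)) * ∑ i, d (f i)))
      (n * (n - 1) * F ^ (n - 2) * (A * B) + n * F ^ (n - 1) * D) := by
  induction n with
  | zero => simp
  | succ n ih =>
    rw [← (Fin.consEquiv fun _ => T).hasSum_iff]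
    refine CriticalLaw.hasSum_of_eq ((((hcd.mul_prod_complex (hasSum_pi_prod hw n)).add
      (hc.mul_prod_complex (hasSum_pi_prod_mul_sum hw hd n))).add
      (hd.mul_prod_complex (hasSum_pi_prod_mul_sum hw hc n))).add
      (hw.mul_prod_complex ih)) (fun f => ?_) ?_
    · simp only [Fin.consEquiv, Fin.prod_univ_succ, Fin.sum_univ_succ, Function.comp_apply,
        Equiv.coe_fn_mk, Fin.cons_zero, Fin.cons_succ]
      ring
    · rcases n with _ | _ | n
      · simp
      · simp
        ring
      · simp only [Nat.add_sub_cancel, show n + 1 + 1 + 1 - 2 = n + 1 by omega,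
          show n + 1 + 1 - 1 = n + 1 by omega]
        push_cast
        ring

end PiSums

namespace PlaneTree

/-- `P(𝒯 = t) z^{|t|}`. -/
noncomputable def weight (p : ℕ → ℝ≥0∞) (z : ℂ) (t : PlaneTree) : ℂ :=
  ((gwProb p t).toReal : ℂ) * z ^ size t

/-- `E z^{|𝒯|}`. -/
noncomputable def Fgen (p : ℕ → ℝ≥0∞) (z : ℂ) : ℂ := ∑' t, weight p z t

theorem weight_graft (p : ℕ → ℝ≥0∞) (z : ℂ) {n : ℕ} (f : Fin n → PlaneTree) :
    weight p z (graft f) = z * (p n).toReal * ∏ i, weight p z (f i) := by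
  simp only [weight, gwProb_graft, size_graft, ENNReal.toReal_mul, ENNReal.toReal_prod,
    Finset.prod_mul_distrib, Finset.prod_pow_eq_pow_sum]
  push_cast
  ring

variable {p : ℕ → ℝ≥0∞} {z x y : ℂ}

theorem summable_gwProb (hp : ∑' k, p k = 1) : Summable fun t => (gwProb p t).toReal :=
  ENNReal.summable_toReal (ne_top_of_le_ne_top ENNReal.one_ne_top (tsum_gwProb_le_one hp))

theorem tsum_gwProb_toReal_le_one (hp : ∑' k, p k = 1) : ∑' t, (gwProb p t).toReal ≤ 1 := by
  have hle := tsum_gwProb_le_one hp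
  have hne := ne_top_of_le_ne_top ENNReal.one_ne_top hle
  rw [← ENNReal.tsum_toReal_eq fun t => ENNReal.ne_top_of_tsum_ne_top hne t]
  simpa using ENNReal.toReal_mono ENNReal.one_ne_top hle

theorem norm_weight (t : PlaneTree) : ‖weight p z t‖ = (gwProb p t).toReal * ‖z‖ ^ size t := by
  simp [weight, abs_of_nonneg]

theorem summable_weight_mul (hp : ∑' k, p k = 1) (hz : ‖z‖ < 1) {c : PlaneTree → ℂ}
    (hc : ∀ t, ‖c t‖ ≤ (size t : ℝ) ^ 2) : Summable fun t => weight p z t * c t := by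
  obtain ⟨M, hM⟩ := (tendsto_pow_const_mul_const_pow_of_abs_lt_one 2
    (by rwa [abs_norm] : |‖z‖| < 1)).bddAbove_range
  refine Summable.of_norm_bounded ((summable_gwProb hp).mul_right M) fun t => ?_
  rw [norm_mul, norm_weight, mul_assoc]
  refine mul_le_mul_of_nonneg_left ?_ ENNReal.toReal_nonneg
  calc ‖z‖ ^ size t * ‖c t‖ ≤ ‖z‖ ^ size t * (size t : ℝ) ^ 2 := by gcongr; exact hc t
    _ = (size t : ℝ) ^ 2 * ‖z‖ ^ size t := mul_comm _ _
    _ ≤ M := hM ⟨size t, rfl⟩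

theorem one_le_size_cast (t : PlaneTree) : (1 : ℝ) ≤ size t := by exact_mod_cast one_le_size t

theorem hasSum_weight (hp : ∑' k, p k = 1) (hz : ‖z‖ < 1) : HasSum (weight p z) (Fgen p z) := by
  refine Summable.hasSum ?_
  simpa using summable_weight_mul hp hz (c := fun _ => 1) fun t => by
    rw [norm_one]
    exact one_le_pow₀ (one_le_size_cast t)

theorem hasSum_weight_mul_depthSum (hp : ∑' k, p k = 1) (hz : ‖z‖ < 1) (hx : ‖x‖ < 1) :
    HasSum (fun t => weight p z t * depthSum x t) (Ggen p z x) :=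
  (summable_weight_mul hp hz fun t => (norm_depthSum_le hx.le t).trans
    (le_self_pow₀ (one_le_size_cast t) two_ne_zero)).hasSum

theorem hasSum_weight_mul_pairSum (hp : ∑' k, p k = 1) (hz : ‖z‖ < 1) (hx : ‖x‖ < 1)
    (hy : ‖y‖ < 1) : HasSum (fun t => weight p z t * pairSum x y t) (Hgen p z x y) :=
  (summable_weight_mul hp hz fun t => norm_pairSum_le hx.le hy.le t).hasSum

theorem norm_Fgen_lt_one (hp : ∑' k, p k = 1) (hz : ‖z‖ < 1) : ‖Fgen p z‖ < 1 := by
  refine lt_of_le_of_lt ?_ hz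
  have hle : ∀ t, ‖weight p z t‖ ≤ (gwProb p t).toReal * ‖z‖ := fun t => by
    rw [norm_weight]
    exact mul_le_mul_of_nonneg_left (pow_le_of_le_one (norm_nonneg _) hz.le
      (Nat.one_le_iff_ne_zero.1 (one_le_size t))) ENNReal.toReal_nonneg
  have hs := (summable_gwProb hp).mul_right ‖z‖
  calc ‖Fgen p z‖ ≤ ∑' t, (gwProb p t).toReal * ‖z‖ := tsum_of_norm_bounded hs.hasSum hle
    _ = (∑' t, (gwProb p t).toReal) * ‖z‖ := tsum_mul_right
    _ ≤ ‖z‖ := mul_le_of_le_one_left (norm_nonneg _) (tsum_gwProb_toReal_le_one hp)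

/-- Decomposition of a convergent sum over trees according to the subtrees of the root. -/
theorem hasSum_of_graft {g : PlaneTree → ℂ} {s : ℂ} (hg : HasSum g s) {r : ℕ → ℂ}
    (hr : ∀ n, HasSum (fun f : Fin n → PlaneTree => g (graft f)) (r n)) : HasSum r s :=
  (graftEquiv.hasSum_iff.2 hg).sigma hr

theorem Fgen_eq_mul_pgf (ha : CriticalLaw fun k => (p k).toReal) (hp : ∑' k, p k = 1)
    (hz : ‖z‖ < 1) : Fgen p z = z * CriticalLaw.pgf (fun k => (p k).toReal) (Fgen p z) := by
  have hw := hasSum_weight hp hz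
  refine (hasSum_of_graft hw fun n => ?_).unique
    ((ha.hasSum_pgf (norm_Fgen_lt_one hp hz).le).mul_left z)
  exact CriticalLaw.hasSum_of_eq ((hasSum_pi_prod hw n).mul_left (z * (p n).toReal))
    (fun f => weight_graft p z f) (by ring)

theorem Ggen_eq_add (ha : CriticalLaw fun k => (p k).toReal) (hp : ∑' k, p k = 1)
    (hz : ‖z‖ < 1) (hx : ‖x‖ < 1) : Ggen p z x = Fgen p z +
      x * (z * CriticalLaw.pgf₁ (fun k => (p k).toReal) (Fgen p z)) * Ggen p z x := by
  have hw := hasSum_weight hp hz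
  have hG := hasSum_weight_mul_depthSum hp hz hx
  have hF := (norm_Fgen_lt_one hp hz).le
  conv_rhs => enter [1]; rw [Fgen_eq_mul_pgf ha hp hz]
  have hsum := ((ha.hasSum_pgf hF).mul_left z).add
    ((ha.hasSum_pgf₁ hF).mul_left (x * z * Ggen p z x))
  have hgraft := hasSum_of_graft hG fun n => CriticalLaw.hasSum_of_eq
    (((hasSum_pi_prod hw n).mul_left (z * (p n).toReal)).add
      ((hasSum_pi_prod_mul_sum hw hG n).mul_left (z * (p n).toReal * x)))
    (fun f => by rw [weight_graft, depthSum_graft]; ring) rfl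
  refine hgraft.unique (CriticalLaw.hasSum_of_eq hsum (fun n => ?_) ?_) <;> ring

theorem Hgen_eq_add (ha : CriticalLaw fun k => (p k).toReal) (hp : ∑' k, p k = 1)
    (hz : ‖z‖ < 1) (hx : ‖x‖ < 1) (hy : ‖y‖ < 1) : Hgen p z x y = Fgen p z +
      z * CriticalLaw.pgf₁ (fun k => (p k).toReal) (Fgen p z) *
        (x * Ggen p z x + y * Ggen p z y + Hgen p z x y) +
      z * x * y * CriticalLaw.pgf₂ (fun k => (p k).toReal) (Fgen p z) *
        (Ggen p z x * Ggen p z y) := by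
  have hw := hasSum_weight hp hz
  have hGx := hasSum_weight_mul_depthSum hp hz hx
  have hGy := hasSum_weight_mul_depthSum hp hz hy
  have hH := hasSum_weight_mul_pairSum hp hz hx hy
  obtain ⟨K, hK⟩ := summable_weight_mul hp hz (c := fun t => depthSum x t * depthSum y t) fun t => by
    rw [norm_mul, sq]
    exact mul_le_mul (norm_depthSum_le hx.le t) (norm_depthSum_le hy.le t) (norm_nonneg _)
      (Nat.cast_nonneg _)
  have hF := (norm_Fgen_lt_one hp hz).le
  conv_rhs => enter [1, 1]; rw [Fgen_eq_mul_pgf ha hp hz]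
  have hsum := (((ha.hasSum_pgf hF).mul_left z).add
    ((ha.hasSum_pgf₁ hF).mul_left (z * (x * Ggen p z x + y * Ggen p z y + Hgen p z x y)))).add
    ((ha.hasSum_pgf₂ hF).mul_left (z * x * y * (Ggen p z x * Ggen p z y)))
  have hlin : HasSum (fun t => weight p z t * (x * depthSum x t + y * depthSum y t +
      (pairSum x y t - x * y * (depthSum x t * depthSum y t))))
      (x * Ggen p z x + y * Ggen p z y + (Hgen p z x y - x * y * K)) :=
    CriticalLaw.hasSum_of_eq (((hGx.mul_left x).add (hGy.mul_left y)).add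
      (hH.sub (hK.mul_left (x * y)))) (fun t => by ring) rfl
  have hgraft := hasSum_of_graft hH fun n => CriticalLaw.hasSum_of_eq
    ((((hasSum_pi_prod hw n).mul_left (z * (p n).toReal)).add
      ((hasSum_pi_prod_mul_sum hw hlin n).mul_left (z * (p n).toReal))).add
      ((hasSum_pi_prod_mul_sum_mul_sum hw hGx hGy hK n).mul_left (z * (p n).toReal * (x * y))))
    (fun f => by
      rw [weight_graft, pairSum_graft, Finset.sum_add_distrib, Finset.sum_add_distrib,
        ← Finset.mul_sum, ← Finset.mul_sum]
      ring) rfl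
  refine hgraft.unique (CriticalLaw.hasSum_of_eq hsum (fun n => ?_) ?_) <;> ring

end PlaneTree

theorem criticalLaw_toReal {p : ℕ → ℝ≥0∞} (hp : ∑' k : ℕ, p k = 1)
    (hmean : ∑' k : ℕ, (k : ℝ≥0∞) * p k = 1)
    (hvar_pos : 0 < xiVar p) (hvar_fin : xiVar p ≠ ⊤)
    (hspan : ∀ e : ℕ, (∀ k : ℕ, p k ≠ 0 → e ∣ k) → e ≤ 1) :
    CriticalLaw fun k => (p k).toReal := by
  have htop : ∀ k, p k ≠ ⊤ := ENNReal.ne_top_of_tsum_ne_top (by rw [hp]; exact ENNReal.one_ne_top)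
  have hsum : HasSum (fun k => (p k).toReal) 1 := by
    have := ENNReal.hasSum_toReal (f := p) (by rw [hp]; exact ENNReal.one_ne_top)
    rwa [← ENNReal.tsum_toReal_eq htop, hp, ENNReal.toReal_one] at this
  have hmsum : HasSum (fun k : ℕ => (k : ℝ) * (p k).toReal) 1 := by
    have := ENNReal.hasSum_toReal (f := fun k : ℕ => (k : ℝ≥0∞) * p k)
      (by rw [hmean]; exact ENNReal.one_ne_top)
    rw [← ENNReal.tsum_toReal_eq
      (ENNReal.ne_top_of_tsum_ne_top (by rw [hmean]; exact ENNReal.one_ne_top)), hmean,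
      ENNReal.toReal_one] at this
    exact CriticalLaw.hasSum_of_eq this (fun k => by simp) rfl
  have hvsum : Summable fun k : ℕ => (p k).toReal * ((k : ℝ) - 1) ^ 2 := by
    refine (ENNReal.summable_toReal hvar_fin).congr fun k => ?_
    rw [ENNReal.toReal_mul, ENNReal.toReal_ofReal (sq_nonneg _)]
  have hcentred : HasSum (fun k : ℕ => ((k : ℝ) - 1) * (p k).toReal) 0 :=
    CriticalLaw.hasSum_of_eq (hmsum.sub hsum) (fun k => by ring) (by ring)
  obtain ⟨j, hj, hj1⟩ : ∃ j, 0 < (p j).toReal ∧ j ≠ 1 := by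
    by_contra! h
    refine hvar_pos.ne' (ENNReal.tsum_eq_zero.2 fun k => ?_)
    by_cases hk : p k = 0
    · simp [hk]
    · simp [h k (ENNReal.toReal_pos hk (htop k))]
  have hnn : ∀ k, 0 ≤ (p k).toReal := fun k => ENNReal.toReal_nonneg
  refine ⟨hnn, ?_, hsum, hmsum, ?_, ?_, fun e he => hspan e fun k hk =>
    he k (ENNReal.toReal_pos hk (htop k)).ne'⟩
  · refine Summable.of_nonneg_of_le (fun k => mul_nonneg (sq_nonneg _) (hnn k)) (fun k => ?_)
      ((hvsum.mul_left 2).add (hsum.summable.mul_left 2))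
    nlinarith [mul_nonneg (sq_nonneg ((k : ℝ) - 2)) (hnn k)]
  · by_contra! h0
    have h0 : (p 0).toReal = 0 := le_antisymm h0 (hnn 0)
    have hterm : ∀ k : ℕ, 0 ≤ ((k : ℝ) - 1) * (p k).toReal := fun k => by
      rcases k with _ | k
      · simp [h0]
      · exact mul_nonneg (by simp) (hnn _)
    have := (hasSum_zero_iff_of_nonneg hterm).1 hcentred
    have := congrFun this j
    simp only [Pi.zero_apply, mul_eq_zero, hj.ne', or_false, sub_eq_zero, Nat.cast_eq_one] at this
    exact hj1 this
  · by_contra! h2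
    have hterm : ∀ k : ℕ, 0 ≤ -(((k : ℝ) - 1) * (p k).toReal) := fun k => by
      rcases k with _ | _ | k
      · simp
      · simp
      · simp [le_antisymm (h2 (k + 1 + 1) (by omega)) (hnn _)]
    have := (hasSum_zero_iff_of_nonneg hterm).1 (by simpa using hcentred.neg)
    have := congrFun this j
    simp only [Pi.zero_apply, neg_eq_zero, mul_eq_zero, hj.ne', or_false, sub_eq_zero,
      Nat.cast_eq_one] at this
    exact hj1 this

namespace CriticalLaw

variable {a : ℕ → ℝ}

/-- `z Φ'(F(z))`. -/
noncomputable def slope (a : ℕ → ℝ) (z : ℂ) : ℂ := z * pgf₁ a (branch a z)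

/-- The closed form `F(z) / (1 - x z Φ'(F(z)))` of `G`. -/
noncomputable def Gext (a : ℕ → ℝ) (z x : ℂ) : ℂ := branch a z / (1 - x * slope a z)

/-- The closed form of `H` in terms of `F` and `G`. -/
noncomputable def Hext (a : ℕ → ℝ) (z x y : ℂ) : ℂ :=
  (branch a z + slope a z * (x * Gext a z x + y * Gext a z y) +
    z * x * y * pgf₂ a (branch a z) * (Gext a z x * Gext a z y)) / (1 - slope a z)

theorem analyticAt_branch (ha : CriticalLaw a) {z : ℂ} (hz : z ∈ fixSet a) :
    AnalyticAt ℂ (branch a) z := (ha.fixSet_mem_nhds_and_analyticAt_branch hz).2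

theorem analyticAt_slope (ha : CriticalLaw a) {z : ℂ} (hz : z ∈ fixSet a) :
    AnalyticAt ℂ (slope a) z :=
  analyticAt_id.mul ((ha.analyticAt_pgf₁ (norm_branch_lt hz)).comp (ha.analyticAt_branch hz))

theorem analyticAt_Gext_comp (ha : CriticalLaw a) {E : Type*} [NormedAddCommGroup E]
    [NormedSpace ℂ E] {f g : E → ℂ} {q : E} (hf : AnalyticAt ℂ f q) (hg : AnalyticAt ℂ g q)
    (hz : f q ∈ fixSet a) (hne : 1 - g q * slope a (f q) ≠ 0) :
    AnalyticAt ℂ (fun q => Gext a (f q) (g q)) q :=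
  ((ha.analyticAt_branch hz).comp hf).div
    (analyticAt_const.sub (hg.mul ((ha.analyticAt_slope hz).comp hf))) hne

theorem analyticAt_Hext (ha : CriticalLaw a) {z x y : ℂ} (hz : z ∈ fixSet a)
    (hzne : 1 - slope a z ≠ 0) (hxne : 1 - x * slope a z ≠ 0) (hyne : 1 - y * slope a z ≠ 0) :
    AnalyticAt ℂ (fun q : ℂ × ℂ × ℂ => Hext a q.1 q.2.1 q.2.2) (z, x, y) := by
  have h1 : AnalyticAt ℂ (fun q : ℂ × ℂ × ℂ => q.1) (z, x, y) := analyticAt_fst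
  have h2 : AnalyticAt ℂ (fun q : ℂ × ℂ × ℂ => q.2.1) (z, x, y) := analyticAt_fst.comp analyticAt_snd
  have h3 : AnalyticAt ℂ (fun q : ℂ × ℂ × ℂ => q.2.2) (z, x, y) := analyticAt_snd.comp analyticAt_snd
  have hF : AnalyticAt ℂ (fun q : ℂ × ℂ × ℂ => branch a q.1) (z, x, y) :=
    (ha.analyticAt_branch hz).fun_comp_of_eq h1 rfl
  have hL : AnalyticAt ℂ (fun q : ℂ × ℂ × ℂ => slope a q.1) (z, x, y) :=
    (ha.analyticAt_slope hz).fun_comp_of_eq h1 rfl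
  have hP : AnalyticAt ℂ (fun q : ℂ × ℂ × ℂ => pgf₂ a (branch a q.1)) (z, x, y) :=
    (ha.analyticAt_pgf₂ (norm_branch_lt hz)).fun_comp_of_eq hF rfl
  have hGx := ha.analyticAt_Gext_comp h1 h2 hz hxne
  have hGy := ha.analyticAt_Gext_comp h1 h3 hz hyne
  exact ((hF.add (hL.mul ((h2.mul hGx).add (h3.mul hGy)))).add
    (((h1.mul h2).mul h3).mul hP |>.mul (hGx.mul hGy))).div (analyticAt_const.sub hL) hzne

theorem norm_Gext_le {z x : ℂ} {c : ℝ} (hz : z ∈ fixSet a) (hc : 0 < c) (hx : x ≠ 1)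
    (h : c * ‖1 - x‖ ≤ ‖1 - x * slope a z‖) : ‖Gext a z x‖ ≤ 1 / c / ‖1 - x‖ := by
  have hpos : 0 < ‖1 - x‖ := norm_pos_iff.2 (sub_ne_zero.2 hx.symm)
  rw [Gext, norm_div, div_div]
  exact div_le_div₀ zero_le_one (norm_branch_lt hz).le (mul_pos hc hpos) h

theorem norm_one_sub_le_three {x : ℂ} (hx : ‖x‖ ≤ 2) : ‖1 - x‖ ≤ 3 := by
  have := norm_sub_le 1 x
  rw [norm_one] at this
  linarith

theorem norm_Hext_le (ha : CriticalLaw a) {z x y : ℂ} {c : ℝ} (hz : z ∈ fixSet a) (hc : 0 < c)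
    (hz2 : ‖z‖ ≤ 2) (hx2 : ‖x‖ ≤ 2) (hy2 : ‖y‖ ≤ 2) (hz1 : z ≠ 1) (hx1 : x ≠ 1) (hy1 : y ≠ 1)
    (h : c * ‖1 - z‖ ^ ((1 : ℝ) / 2) ≤ ‖1 - slope a z‖)
    (hx : c * ‖1 - x‖ ≤ ‖1 - x * slope a z‖) (hy : c * ‖1 - y‖ ≤ ‖1 - y * slope a z‖) :
    ‖Hext a z x y‖ ≤ (9 + 24 / c + 8 * (∑' k : ℕ, (k : ℝ) ^ 2 * a k) / c ^ 2) / c /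
      (‖1 - z‖ ^ ((1 : ℝ) / 2) * ‖1 - x‖ * ‖1 - y‖) := by
  have hGx := norm_Gext_le hz hc hx1 hx
  have hGy := norm_Gext_le hz hc hy1 hy
  have hF := (norm_branch_lt hz).le
  have hL : ‖slope a z‖ ≤ 2 := by
    rw [slope, norm_mul]
    exact (mul_le_mul hz2 (ha.norm_pgf₁_lt_one (norm_branch_lt hz)).le (norm_nonneg _)
      zero_le_two).trans_eq (mul_one _)
  have hP := ha.norm_pgf₂_le hF
  set S := ∑' k : ℕ, (k : ℝ) ^ 2 * a k
  have hS : 0 ≤ S := (norm_nonneg _).trans hP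
  have hX : 0 < ‖1 - x‖ := norm_pos_iff.2 (sub_ne_zero.2 hx1.symm)
  have hY : 0 < ‖1 - y‖ := norm_pos_iff.2 (sub_ne_zero.2 hy1.symm)
  have hZ : 0 < ‖1 - z‖ ^ ((1 : ℝ) / 2) :=
    Real.rpow_pos_of_pos (norm_pos_iff.2 (sub_ne_zero.2 hz1.symm)) _
  have hX3 := norm_one_sub_le_three hx2
  have hY3 := norm_one_sub_le_three hy2
  set X := ‖1 - x‖
  set Y := ‖1 - y‖
  have hnum : ‖branch a z + slope a z * (x * Gext a z x + y * Gext a z y) +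
      z * x * y * pgf₂ a (branch a z) * (Gext a z x * Gext a z y)‖
      ≤ (9 + 24 / c + 8 * S / c ^ 2) / (X * Y) := by
    calc _ ≤ ‖branch a z‖ + ‖slope a z‖ * (‖x‖ * ‖Gext a z x‖ + ‖y‖ * ‖Gext a z y‖) +
          ‖z‖ * ‖x‖ * ‖y‖ * ‖pgf₂ a (branch a z)‖ * (‖Gext a z x‖ * ‖Gext a z y‖) := by
          refine (norm_add₃_le).trans ?_
          simp only [norm_mul]
          gcongr
          refine (norm_add_le _ _).trans_eq ?_
          simp only [norm_mul]
      _ ≤ 1 + 2 * (2 * (1 / c / X) + 2 * (1 / c / Y)) + 2 * 2 * 2 * S * (1 / c / X * (1 / c / Y)) := by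
          gcongr
      _ = (X * Y + 4 / c * (X + Y) + 8 * S / c ^ 2) / (X * Y) := by
          field_simp
          ring
      _ ≤ _ := by
          have h1 : X * Y ≤ 9 := by nlinarith
          have h2 : 4 / c * (X + Y) ≤ 24 / c := by
            rw [div_mul_eq_mul_div]
            gcongr
            linarith
          gcongr
  rw [Hext, norm_div]
  refine (div_le_div₀ (by positivity) hnum (mul_pos hc hZ) h).trans_eq ?_
  field_simp

variable {p : ℕ → ℝ≥0∞} {z x y : ℂ}

theorem branch_eq_Fgen (ha : CriticalLaw fun k => (p k).toReal) (hp : ∑' k, p k = 1)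
    (hz : ‖z‖ < 1) : branch (fun k => (p k).toReal) z = PlaneTree.Fgen p z :=
  ha.branch_eq (PlaneTree.norm_Fgen_lt_one hp hz) (PlaneTree.Fgen_eq_mul_pgf ha hp hz)

theorem norm_slope_lt_one (ha : CriticalLaw fun k => (p k).toReal) (hp : ∑' k, p k = 1)
    (hz : ‖z‖ < 1) : ‖slope (fun k => (p k).toReal) z‖ < 1 := by
  rw [slope, branch_eq_Fgen ha hp hz, norm_mul]
  exact mul_lt_one_of_nonneg_of_lt_one_left (norm_nonneg _) hz
    (ha.norm_pgf₁_lt_one (PlaneTree.norm_Fgen_lt_one hp hz)).le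

theorem one_sub_ne_zero_of_norm_lt_one {u : ℂ} (hu : ‖u‖ < 1) : 1 - u ≠ 0 := by
  intro h
  rw [← sub_eq_zero.1 h, norm_one] at hu
  exact lt_irrefl _ hu

theorem Gext_eq_Ggen (ha : CriticalLaw fun k => (p k).toReal) (hp : ∑' k, p k = 1)
    (hz : ‖z‖ < 1) (hx : ‖x‖ < 1) : Gext (fun k => (p k).toReal) z x = Ggen p z x := by
  have hs := norm_slope_lt_one ha hp hz
  have hne : 1 - x * slope (fun k => (p k).toReal) z ≠ 0 := by
    refine one_sub_ne_zero_of_norm_lt_one ?_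
    rw [norm_mul]
    exact mul_lt_one_of_nonneg_of_lt_one_left (norm_nonneg _) hx hs.le
  have h := PlaneTree.Ggen_eq_add ha hp hz hx
  rw [← branch_eq_Fgen ha hp hz, ← slope] at h
  rw [Gext, div_eq_iff hne]
  linear_combination -h

theorem Hext_eq_Hgen (ha : CriticalLaw fun k => (p k).toReal) (hp : ∑' k, p k = 1)
    (hz : ‖z‖ < 1) (hx : ‖x‖ < 1) (hy : ‖y‖ < 1) :
    Hext (fun k => (p k).toReal) z x y = Hgen p z x y := by
  have hne := one_sub_ne_zero_of_norm_lt_one (norm_slope_lt_one ha hp hz)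
  have h := PlaneTree.Hgen_eq_add ha hp hz hx hy
  rw [← branch_eq_Fgen ha hp hz, ← slope] at h
  rw [Hext, Gext_eq_Ggen ha hp hz hx, Gext_eq_Ggen ha hp hz hy, div_eq_iff hne]
  linear_combination -h

end CriticalLaw

/-- bounds (4.6) and (4.7) of Lemma 7 of Devroye–Janson.  If `ξ` has
span 1, then `G` and `H` extend analytically to `Δ(β, δ)²` and `Δ(β, δ)³` respectively,
with `|G(z,x)| ≤ C |1-x|⁻¹` and `|H(z,x,y)| ≤ C |1-z|^{-1/2} |1-x|⁻¹ |1-y|⁻¹`. -/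
theorem Ggen_Hgen_extend_and_bound
    (p : ℕ → ℝ≥0∞) (hp : ∑' k : ℕ, p k = 1)
    (hmean : ∑' k : ℕ, (k : ℝ≥0∞) * p k = 1)
    (hvar_pos : 0 < xiVar p) (hvar_fin : xiVar p ≠ ⊤)
    (hspan : ∀ e : ℕ, (∀ k : ℕ, p k ≠ 0 → e ∣ k) → e ≤ 1) :
    ∃ β δ C : ℝ, 0 < β ∧ β < Real.pi / 2 ∧ 0 < δ ∧ 0 < C ∧
      (∃ G : ℂ × ℂ → ℂ,
        AnalyticOnNhd ℂ G (Delta β δ ×ˢ Delta β δ) ∧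
        (∀ z x : ℂ, ‖z‖ < 1 → ‖x‖ < 1 → G (z, x) = Ggen p z x) ∧
        ∀ z ∈ Delta β δ, ∀ x ∈ Delta β δ, ‖G (z, x)‖ ≤ C / ‖1 - x‖) ∧
      ∃ H : ℂ × ℂ × ℂ → ℂ,
        AnalyticOnNhd ℂ H (Delta β δ ×ˢ Delta β δ ×ˢ Delta β δ) ∧
        (∀ z x y : ℂ, ‖z‖ < 1 → ‖x‖ < 1 → ‖y‖ < 1 → H (z, x, y) = Hgen p z x y) ∧
        ∀ z ∈ Delta β δ, ∀ x ∈ Delta β δ, ∀ y ∈ Delta β δ,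
          ‖H (z, x, y)‖ ≤ C / (‖1 - z‖ ^ ((1 : ℝ) / 2) * ‖1 - x‖ * ‖1 - y‖) := by
  have ha := criticalLaw_toReal hp hmean hvar_pos hvar_fin hspan
  obtain ⟨δ, c, hδ, hδ1, hc, hsub, hb⟩ := ha.exists_Delta_bounds
  set a : ℕ → ℝ := fun k => (p k).toReal
  set β := Real.arcsin (1 / 4)
  have hβ : 0 < β := Real.arcsin_pos.2 (by norm_num)
  have hβ2 : β < Real.pi / 2 := Real.arcsin_lt_pi_div_two.2 (by norm_num)
  have hnorm : ∀ z ∈ Delta β δ, ‖z‖ ≤ 2 := fun z hz => by linarith [hz.1]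
  have hone : ∀ z ∈ Delta β δ, z ≠ 1 := fun z hz => hz.2.1
  have hpos : ∀ z ∈ Delta β δ, 0 < ‖1 - z‖ := fun z hz =>
    norm_pos_iff.2 (sub_ne_zero.2 (hone z hz).symm)
  have hbz : ∀ z ∈ Delta β δ,
      c * ‖1 - z‖ ^ ((1 : ℝ) / 2) ≤ ‖1 - CriticalLaw.slope a z‖ := fun z hz => (hb z hz).1
  have hbx : ∀ z ∈ Delta β δ, ∀ x ∈ Delta β δ,
      c * ‖1 - x‖ ≤ ‖1 - x * CriticalLaw.slope a z‖ := fun z hz => (hb z hz).2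
  have hnex : ∀ z ∈ Delta β δ, ∀ x ∈ Delta β δ, 1 - x * CriticalLaw.slope a z ≠ 0 :=
    fun z hz x hx => norm_pos_iff.1 ((mul_pos hc (hpos x hx)).trans_le (hbx z hz x hx))
  have hnez : ∀ z ∈ Delta β δ, 1 - CriticalLaw.slope a z ≠ 0 := fun z hz =>
    norm_pos_iff.1 ((mul_pos hc (Real.rpow_pos_of_pos (hpos z hz) _)).trans_le (hbz z hz))
  set S := ∑' k : ℕ, (k : ℝ) ^ 2 * a k with hS
  have hS0 : 0 ≤ S := tsum_nonneg fun k => mul_nonneg (sq_nonneg _) (ha.nonneg k)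
  set N := (9 + 24 / c + 8 * S / c ^ 2) / c with hN
  have hN0 : 0 < N := by positivity
  refine ⟨β, δ, max (1 / c) N, hβ, hβ2, hδ, lt_max_of_lt_right hN0,
    ⟨fun q => CriticalLaw.Gext a q.1 q.2, ?_, fun z x hz hx => ?_, fun z hz x hx => ?_⟩,
    ⟨fun q => CriticalLaw.Hext a q.1 q.2.1 q.2.2, ?_, fun z x y hz hx hy => ?_,
      fun z hz x hx y hy => ?_⟩⟩
  · rintro ⟨z, x⟩ ⟨hz, hx⟩
    exact ha.analyticAt_Gext_comp analyticAt_fst analyticAt_snd (hsub hz) (hnex z hz x hx)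
  · exact CriticalLaw.Gext_eq_Ggen ha hp hz hx
  · refine (CriticalLaw.norm_Gext_le (hsub hz) hc (hone x hx) (hbx z hz x hx)).trans ?_
    gcongr
    exact le_max_left _ _
  · rintro ⟨z, x, y⟩ ⟨hz, hx, hy⟩
    exact ha.analyticAt_Hext (hsub hz) (hnez z hz) (hnex z hz x hx) (hnex z hz y hy)
  · exact CriticalLaw.Hext_eq_Hgen ha hp hz hx hy
  · refine (ha.norm_Hext_le (hsub hz) hc (hnorm z hz) (hnorm x hx) (hnorm y hy) (hone z hz)
      (hone x hx) (hone y hy) (hbz z hz) (hbx z hz x hx) (hbx z hz y hy)).trans ?_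
    gcongr
    exact le_max_right _ _
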